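/- Let n ≥ 4 and let ρ : B_n → B_n be an injective group homomorphism. Then ρ maps the center of B_n into the center of B_n, i.e., ρ(Z(B_n)) ≤ Z(B_n); equivalently, ρ(z) is central, where z is the full twist. -/

import Mathlib

/-- Relators for the braid group with generators `σ_0, …, σ_{m-1}`:
the braid relations `σ_i σ_j σ_i = σ_j σ_i σ_j` for `j = i+1`, and the
commutation relations `σ_i σ_j = σ_j σ_i` for `j ≥ i+2`. -/
def braidRels (m : ℕ) : Set (FreeGroup (Fin m)) :=
  { r | ∃ i j : Fin m,
      ((i : ℕ) + 1 = (j : ℕ) ∧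
        r = FreeGroup.of i * FreeGroup.of j * FreeGroup.of i *
            (FreeGroup.of j * FreeGroup.of i * FreeGroup.of j)⁻¹) ∨
      ((i : ℕ) + 2 ≤ (j : ℕ) ∧
        r = FreeGroup.of i * FreeGroup.of j * (FreeGroup.of j * FreeGroup.of i)⁻¹) }

/-- The braid group on `n` strands: the presented group with generators
`σ_1, …, σ_{n-1}` (indexed by `Fin (n-1)`) and the braid relators. -/
abbrev BraidGroup (n : ℕ) : Type := PresentedGroup (braidRels (n - 1))

/-- The standard generator `σ_{i+1}` of the braid group (0-indexed). -/
def braidσ (n : ℕ) (i : Fin (n - 1)) : BraidGroup n := PresentedGroup.of i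

/-- The element `δ = σ_1 σ_2 ⋯ σ_{n-1}` of the braid group. -/
def braidδ (n : ℕ) : BraidGroup n := (List.ofFn (braidσ n)).prod

/-- The full twist `z = (σ_1 σ_2 ⋯ σ_{n-1})^n`. -/
def fullTwist (n : ℕ) : BraidGroup n := braidδ n ^ n

namespace Braid

open Equiv (Perm)

/-- The generator `σ_i` of the braid group, extended by `1` to all indices `i : ℕ`. -/
def s (n i : ℕ) : BraidGroup n := if h : i < n - 1 then braidσ n ⟨i, h⟩ else 1

/-- The braid relations for the first `n - 1` terms of a sequence in a group. -/
structure IsBraidSeq {G : Type*} [Group G] (n : ℕ) (f : ℕ → G) : Prop where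
  braid : ∀ i, i + 2 < n → f i * f (i + 1) * f i = f (i + 1) * f i * f (i + 1)
  comm : ∀ i j, i + 2 ≤ j → j + 1 < n → f i * f j = f j * f i

section Basic

variable {G : Type*} [Group G] {n : ℕ}

theorem s_of_lt {i : ℕ} (h : i < n - 1) : s n i = PresentedGroup.of ⟨i, h⟩ := by
  simp [s, h, braidσ]

theorem isBraidSeq_s (n : ℕ) : IsBraidSeq n (s n) where
  braid i hi := by
    rw [s_of_lt (by omega : i < n - 1), s_of_lt (by omega : i + 1 < n - 1)]
    apply PresentedGroup.mk_eq_mk_of_mul_inv_mem (rels := braidRels (n - 1))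
      (x := .of _ * .of _ * .of _) (y := .of _ * .of _ * .of _)
    exact ⟨⟨i, by omega⟩, ⟨i + 1, by omega⟩, Or.inl ⟨rfl, rfl⟩⟩
  comm i j hij hj := by
    rw [s_of_lt (by omega : i < n - 1), s_of_lt (by omega : j < n - 1)]
    apply PresentedGroup.mk_eq_mk_of_mul_inv_mem (rels := braidRels (n - 1))
      (x := .of _ * .of _) (y := .of _ * .of _)
    exact ⟨⟨i, by omega⟩, ⟨j, by omega⟩, Or.inr ⟨hij, rfl⟩⟩

theorem IsBraidSeq.map {f : ℕ → G} (hf : IsBraidSeq n f) {K : Type*} [Group K] (φ : G →* K) :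
    IsBraidSeq n (fun i => φ (f i)) where
  braid i hi := by simpa using congrArg φ (hf.braid i hi)
  comm i j hij hj := by simpa using congrArg φ (hf.comm i j hij hj)

theorem IsBraidSeq.mono {f : ℕ → G} {m : ℕ} (hf : IsBraidSeq n f) (h : m ≤ n) :
    IsBraidSeq m f :=
  ⟨fun i hi => hf.braid i (by omega), fun i j hij hj => hf.comm i j hij (by omega)⟩

/-- The universal property of the braid group. -/
def lift (f : ℕ → G) (hf : IsBraidSeq n f) : BraidGroup n →* G :=
  PresentedGroup.toGroup (f := fun i : Fin (n - 1) => f i) <| by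
    rintro r ⟨i, j, ⟨hij, rfl⟩ | ⟨hij, rfl⟩⟩
    · have := hf.braid i (by omega)
      rw [hij] at this
      simp [this]
    · have := hf.comm i j hij (by omega)
      simp [this]

@[simp] theorem lift_s (f : ℕ → G) (hf : IsBraidSeq n f) {i : ℕ} (h : i + 1 < n) :
    lift f hf (s n i) = f i := by
  rw [s_of_lt (by omega)]
  exact PresentedGroup.toGroup.of _

theorem closure_s (n : ℕ) : Subgroup.closure {g | ∃ i, i + 1 < n ∧ g = s n i} = ⊤ := by
  rw [eq_top_iff, ← PresentedGroup.closure_range_of, Subgroup.closure_le]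
  rintro _ ⟨i, rfl⟩
  exact Subgroup.subset_closure ⟨i, by omega, (s_of_lt i.2).symm⟩

theorem hom_ext {φ ψ : BraidGroup n →* G} (h : ∀ i, i + 1 < n → φ (s n i) = ψ (s n i)) :
    φ = ψ := by
  refine MonoidHom.eq_of_eqOn_dense (closure_s n) ?_
  rintro _ ⟨i, hi, rfl⟩
  exact h i hi

theorem induction_on {p : BraidGroup n → Prop} (g : BraidGroup n) (one : p 1)
    (gen : ∀ i, i + 1 < n → p (s n i)) (mul : ∀ x y, p x → p y → p (x * y))
    (inv : ∀ x, p x → p x⁻¹) : p g := by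
  have hg : g ∈ Subgroup.closure {g | ∃ i, i + 1 < n ∧ g = s n i} := by
    rw [closure_s]; trivial
  induction hg using Subgroup.closure_induction with
  | mem x hx => obtain ⟨i, hi, rfl⟩ := hx; exact gen i hi
  | one => exact one
  | mul x y _ _ hx hy => exact mul x y hx hy
  | inv x _ hx => exact inv x hx

theorem mem_center_iff {g : BraidGroup n} :
    g ∈ Subgroup.center (BraidGroup n) ↔ ∀ i, i + 1 < n → Commute (s n i) g := by
  rw [Subgroup.mem_center_iff]
  refine ⟨fun h i _ => h _, fun h x => ?_⟩
  induction x using induction_on with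
  | one => simp
  | gen i hi => exact h i hi
  | mul x y hx hy => exact Commute.mul_left hx hy
  | inv x hx => exact Commute.inv_left hx

theorem commute_s {i j : ℕ} (h : i + 2 ≤ j ∨ j + 2 ≤ i) (hi : i + 1 < n) (hj : j + 1 < n) :
    Commute (s n i) (s n j) := by
  rcases h with h | h
  · exact (isBraidSeq_s n).comm i j h hj
  · exact ((isBraidSeq_s n).comm j i h hi).symm

theorem braid_s {i : ℕ} (h : i + 2 < n) :
    s n i * s n (i + 1) * s n i = s n (i + 1) * s n i * s n (i + 1) :=
  (isBraidSeq_s n).braid i h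

end Basic

section Cocycle

variable {J H : Type*} [Group H]

/-- The permutation of `J × H` given by `σ` on `J` and left translation by `c` on fibres. -/
def twist (σ : Perm J) (c : J → H) : Perm (J × H) where
  toFun x := (σ x.1, c x.1 * x.2)
  invFun x := (σ.symm x.1, (c (σ.symm x.1))⁻¹ * x.2)
  left_inv x := by simp
  right_inv x := by simp

@[simp] theorem twist_apply (σ : Perm J) (c : J → H) (x : J × H) :
    twist σ c x = (σ x.1, c x.1 * x.2) := rfl

theorem twist_mul (σ τ : Perm J) (c d : J → H) :
    twist σ c * twist τ d = twist (σ * τ) (fun j => c (τ j) * d j) := by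
  ext x <;> simp [mul_assoc]

theorem twist_inv (σ : Perm J) (c : J → H) :
    (twist σ c)⁻¹ = twist σ⁻¹ (fun j => (c (σ⁻¹ j))⁻¹) := by
  rw [inv_eq_iff_mul_eq_one, twist_mul]
  ext x <;> simp

theorem twist_one : twist (1 : Perm J) (fun _ => (1 : H)) = 1 := by
  ext x <;> simp

variable {n : ℕ} {σ : ℕ → Perm J} {c : ℕ → J → H}

/-- The cocycle on the braid group determined by its values `c` on the generators. -/
def cocycle (h : IsBraidSeq n fun i => twist (σ i) (c i)) (g : BraidGroup n) (j : J) : H :=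
  (lift _ h g (j, 1)).2

theorem lift_twist (h : IsBraidSeq n fun i => twist (σ i) (c i)) (hσ : IsBraidSeq n σ)
    (g : BraidGroup n) : lift _ h g = twist (lift σ hσ g) (cocycle h g) := by
  suffices ∃ d, lift _ h g = twist (lift σ hσ g) d by
    obtain ⟨d, hd⟩ := this
    have : cocycle h g = d := by ext j; simp [cocycle, hd]
    rw [hd, this]
  induction g using induction_on with
  | one => exact ⟨fun _ => 1, by simp [twist_one]⟩
  | gen i hi => exact ⟨c i, by simp [hi]⟩
  | mul x y hx hy =>
    obtain ⟨d, hd⟩ := hx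
    obtain ⟨e, he⟩ := hy
    exact ⟨_, by rw [map_mul, hd, he, twist_mul, map_mul]⟩
  | inv x hx =>
    obtain ⟨d, hd⟩ := hx
    exact ⟨_, by rw [map_inv, hd, twist_inv, map_inv]⟩

theorem cocycle_s (h : IsBraidSeq n fun i => twist (σ i) (c i)) {i : ℕ} (hi : i + 1 < n) (j : J) :
    cocycle h (s n i) j = c i j := by
  simp [cocycle, hi]

theorem cocycle_one (h : IsBraidSeq n fun i => twist (σ i) (c i)) (j : J) :
    cocycle h 1 j = 1 := by
  simp [cocycle]

theorem cocycle_mul (h : IsBraidSeq n fun i => twist (σ i) (c i)) (hσ : IsBraidSeq n σ)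
    (x y : BraidGroup n) (j : J) :
    cocycle h (x * y) j = cocycle h x (lift σ hσ y j) * cocycle h y j := by
  rw [cocycle, map_mul, lift_twist h hσ, lift_twist h hσ, twist_mul]
  simp

end Cocycle

section Permutation

/-- The adjacent transposition `(i, i + 1)` of `ℕ`. -/
def sw (i : ℕ) : Perm ℕ := Equiv.swap i (i + 1)

theorem sw_apply (i a : ℕ) : sw i a = if a = i then i + 1 else if a = i + 1 then i else a :=
  Equiv.swap_apply_def _ _ _

theorem isBraidSeq_sw (n : ℕ) : IsBraidSeq n sw where
  braid i _ := by
    ext a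
    simp only [Equiv.Perm.mul_apply, sw_apply]
    grind
  comm i j _ _ := by
    ext a
    simp only [Equiv.Perm.mul_apply, sw_apply]
    grind

/-- The permutation of the strands underlying a braid, acting on `ℕ`. -/
def perm (n : ℕ) : BraidGroup n →* Perm ℕ := lift sw (isBraidSeq_sw n)

@[simp] theorem perm_s {n i : ℕ} (h : i + 1 < n) : perm n (s n i) = sw i := lift_s _ _ h

theorem perm_apply_of_le {n : ℕ} (g : BraidGroup n) {a : ℕ} (ha : n ≤ a) : perm n g a = a := by
  induction g using induction_on with
  | one => simp
  | gen i hi => rw [perm_s hi, sw_apply]; grind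
  | mul x y hx hy => simp [hx, hy]
  | inv x hx => rw [map_inv, Equiv.Perm.inv_eq_iff_eq, hx]

theorem perm_apply_lt {n : ℕ} (g : BraidGroup n) {a : ℕ} (ha : a < n) : perm n g a < n := by
  by_contra! h
  have := perm_apply_of_le g h
  rw [(perm n g).injective this] at h
  omega

/-- The permutation of the strands underlying a braid, acting on `Fin n`. -/
def permFin (n : ℕ) : BraidGroup n →* Perm (Fin n) where
  toFun g :=
    { toFun a := ⟨perm n g a, perm_apply_lt g a.2⟩
      invFun a := ⟨perm n g⁻¹ a, perm_apply_lt g⁻¹ a.2⟩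
      left_inv a := by simp
      right_inv a := by simp }
  map_one' := by ext; simp
  map_mul' x y := by ext; simp

@[simp] theorem permFin_apply {n : ℕ} (g : BraidGroup n) (a : Fin n) :
    (permFin n g a : ℕ) = perm n g a := rfl

theorem permFin_eq_one_iff {n : ℕ} {g : BraidGroup n} : permFin n g = 1 ↔ perm n g = 1 := by
  refine ⟨fun h => ?_, fun h => ?_⟩
  · ext a
    rcases lt_or_ge a n with ha | ha
    · simpa using congrArg Fin.val (Equiv.congr_fun h ⟨a, ha⟩)
    · simpa using perm_apply_of_le g ha
  · ext a
    simp [h]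

end Permutation

section Crossing

theorem isBraidSeq_cross (n : ℕ) : IsBraidSeq n fun i =>
    twist ((sw i).prodCongr (sw i)) fun p : ℕ × ℕ =>
      Multiplicative.ofAdd (if p.1 = i ∧ p.2 = i + 1 then (1 : ℤ) else 0) where
  braid i _ := by
    ext ⟨⟨a, b⟩, t⟩ <;> simp [sw_apply, ← mul_assoc, ← ofAdd_add] <;> grind
  comm i j _ _ := by
    ext ⟨⟨a, b⟩, t⟩ <;> simp [sw_apply, ← mul_assoc, ← ofAdd_add] <;> grind

theorem isBraidSeq_swProd (n : ℕ) :
    IsBraidSeq n fun i => ((sw i).prodCongr (sw i) : Perm (ℕ × ℕ)) where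
  braid i h := by
    have := DFunLike.congr_fun ((isBraidSeq_sw n).braid i h)
    ext ⟨a, b⟩ <;> simpa using this _
  comm i j h h' := by
    have := DFunLike.congr_fun ((isBraidSeq_sw n).comm i j h h')
    ext ⟨a, b⟩ <;> simpa using this _

theorem lift_swProd {n : ℕ} (g : BraidGroup n) (a b : ℕ) :
    lift _ (isBraidSeq_swProd n) g (a, b) = (perm n g a, perm n g b) := by
  have : lift _ (isBraidSeq_swProd n) g = (perm n g).prodCongr (perm n g) := by
    induction g using induction_on with
    | one => simp; rfl
    | gen i hi => simp [hi]
    | mul x y hx hy => rw [map_mul, map_mul, hx, hy]; rfl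
    | inv x hx => rw [map_inv, map_inv, hx]; rfl
  rw [this]
  rfl

/-- The signed number of crossings of a braid at which the strand starting in position `a`
crosses the strand starting in position `b` from the left. -/
def cross {n : ℕ} (g : BraidGroup n) (a b : ℕ) : ℤ :=
  (cocycle (isBraidSeq_cross n) g (a, b)).toAdd

theorem cross_s {n i : ℕ} (hi : i + 1 < n) (a b : ℕ) :
    cross (s n i) a b = if a = i ∧ b = i + 1 then 1 else 0 := by
  simp [cross, cocycle_s _ hi]

@[simp] theorem cross_one {n : ℕ} (a b : ℕ) : cross (1 : BraidGroup n) a b = 0 := by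
  simp [cross, cocycle_one]

theorem cross_mul {n : ℕ} (x y : BraidGroup n) (a b : ℕ) :
    cross (x * y) a b = cross x (perm n y a) (perm n y b) + cross y a b := by
  simp [cross, cocycle_mul _ (isBraidSeq_swProd n), lift_swProd]

theorem cross_inv {n : ℕ} (x : BraidGroup n) (a b : ℕ) :
    cross x⁻¹ a b = - cross x (perm n x⁻¹ a) (perm n x⁻¹ b) := by
  have := cross_mul x x⁻¹ a b
  rw [mul_inv_cancel, cross_one] at this
  omega

theorem cross_sub_cross_swap {n : ℕ} (g : BraidGroup n) {a b : ℕ} (hab : a ≠ b) :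
    cross g a b - cross g b a =
      (if a < b then 1 else 0) - (if perm n g a < perm n g b then 1 else 0) := by
  induction g using induction_on generalizing a b with
  | one => simp
  | gen i hi =>
    rw [cross_s hi, cross_s hi, perm_s hi, sw_apply, sw_apply]
    grind
  | mul x y hx hy =>
    have h1 := hx (a := perm n y a) (b := perm n y b) (by simpa using hab)
    have h2 := hy hab
    rw [cross_mul, cross_mul, map_mul, Perm.mul_apply, Perm.mul_apply]
    omega
  | inv x hx =>
    have h1 := hx (a := perm n x⁻¹ a) (b := perm n x⁻¹ b) (by simpa using hab)
    rw [cross_inv, cross_inv]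
    simp only [map_inv, Perm.coe_inv, Equiv.apply_symm_apply] at h1 ⊢
    omega

/-- A braid whose square is trivial is pure. -/
theorem perm_eq_one_of_sq_eq_one {n : ℕ} {g : BraidGroup n} (hg : g ^ 2 = 1) : perm n g = 1 := by
  ext a
  by_contra h
  have hsq : perm n g (perm n g a) = a := by
    rw [← Perm.mul_apply, ← map_mul, ← sq, hg, map_one, Perm.one_apply]
  have h1 := cross_mul g g a (perm n g a)
  rw [← sq, hg, cross_one, hsq] at h1
  have h2 := cross_sub_cross_swap g (a := a) (b := perm n g a) (fun e => h e.symm)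
  rw [hsq] at h2
  simp only [Perm.one_apply] at h
  split_ifs at h2 <;> omega

end Crossing

section Artin

/-- The endomorphism of the free group underlying the Artin action of `σ_i`. -/
def artinHom (i : ℕ) : FreeGroup ℕ →* FreeGroup ℕ :=
  FreeGroup.lift fun j =>
    if j = i then (.of i)⁻¹ * .of (i + 1) * .of i else if j = i + 1 then .of i else .of j

/-- The inverse of `artinHom i`. -/
def artinInv (i : ℕ) : FreeGroup ℕ →* FreeGroup ℕ :=
  FreeGroup.lift fun j =>
    if j = i then .of (i + 1) else
      if j = i + 1 then .of (i + 1) * .of i * (.of (i + 1))⁻¹ else .of j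

theorem artinHom_of (i j : ℕ) : artinHom i (.of j) =
    if j = i then (.of i)⁻¹ * .of (i + 1) * .of i else if j = i + 1 then .of i else .of j := by
  simp [artinHom]

theorem artinInv_of (i j : ℕ) : artinInv i (.of j) =
    if j = i then .of (i + 1) else
      if j = i + 1 then .of (i + 1) * .of i * (.of (i + 1))⁻¹ else .of j := by
  simp [artinInv]

/-- The Artin automorphism of the free group attached to `σ_i`. -/
def artinAut (i : ℕ) : MulAut (FreeGroup ℕ) :=
  MonoidHom.toMulEquiv (artinHom i) (artinInv i)
    (by
      ext j
      simp only [MonoidHom.comp_apply, MonoidHom.id_apply, artinHom_of]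
      split_ifs with h h' <;> simp [artinInv_of, h, mul_assoc]
      · simp [h']
      · omega)
    (by
      ext j
      simp only [MonoidHom.comp_apply, MonoidHom.id_apply, artinInv_of]
      split_ifs with h h' <;> simp [artinHom_of, h, mul_assoc]
      · simp [h']
      · omega)

theorem artinAut_of (i j : ℕ) : artinAut i (.of j) =
    if j = i then (.of i)⁻¹ * .of (i + 1) * .of i else if j = i + 1 then .of i else .of j :=
  artinHom_of i j

theorem mulAut_ext {φ ψ : MulAut (FreeGroup ℕ)} (h : ∀ j, φ (.of j) = ψ (.of j)) : φ = ψ := by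
  apply MulEquiv.toMonoidHom_injective
  ext j
  exact h j

theorem isBraidSeq_artinAut (n : ℕ) : IsBraidSeq n artinAut where
  braid i _ := by
    refine mulAut_ext fun j => ?_
    simp only [MulAut.mul_apply, artinAut_of]
    have e1 : i ≠ i + 1 + 1 := by omega
    rcases eq_or_ne j i with rfl | h1
    · simp [artinAut_of, mul_assoc, e1, e1.symm]
    rcases eq_or_ne j (i + 1) with rfl | h2
    · simp [artinAut_of, e1, e1.symm]
    rcases eq_or_ne j (i + 2) with rfl | h3
    · simp [artinAut_of, e1]
    simp [artinAut_of, h1, h2, h3]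
  comm i k hik _ := by
    refine mulAut_ext fun j => ?_
    simp only [MulAut.mul_apply, artinAut_of]
    have e1 : i ≠ k := by omega
    have e2 : i ≠ k + 1 := by omega
    have e3 : i + 1 ≠ k := by omega
    rcases eq_or_ne j i with rfl | h1
    · simp [artinAut_of, *]
    rcases eq_or_ne j (i + 1) with rfl | h2
    · simp [artinAut_of, *]
    rcases eq_or_ne j k with rfl | h3
    · simp [artinAut_of, *, e1.symm, e2.symm, e3.symm]
    rcases eq_or_ne j (k + 1) with rfl | h4
    · simp [artinAut_of, *, e1.symm, e2.symm, e3.symm]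
    simp [artinAut_of, h1, h2, h3, h4]

/-- The Artin action of the braid group on a free group. -/
def artin (n : ℕ) : BraidGroup n →* MulAut (FreeGroup ℕ) := lift artinAut (isBraidSeq_artinAut n)

/-- The semidirect product of the braid group with a free group along the Artin action. -/
abbrev ArtinProd (n : ℕ) := FreeGroup ℕ ⋊[artin n] BraidGroup n

/-- The generators of the free factor of `ArtinProd n`. -/
def px (n j : ℕ) : ArtinProd n := SemidirectProduct.inl (.of j)

/-- The braid generators of `ArtinProd n`. -/
def ps (n i : ℕ) : ArtinProd n := SemidirectProduct.inr (s n i)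

variable {n : ℕ}

theorem artin_s {i : ℕ} (hi : i + 1 < n) : artin n (s n i) = artinAut i := lift_s _ _ hi

theorem ps_mul_px {i : ℕ} (hi : i + 1 < n) (j : ℕ) :
    ps n i * px n j = SemidirectProduct.inl (artinAut i (.of j)) * ps n i := by
  have := SemidirectProduct.inl_aut (φ := artin n) (s n i) (.of j)
  rw [artin_s hi] at this
  rw [ps, px, this, map_inv, inv_mul_cancel_right]

theorem px_mul_ps {i : ℕ} (hi : i + 1 < n) : px n i * ps n i = ps n i * px n (i + 1) := by
  rw [ps_mul_px hi, artinAut_of]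
  simp [px]

theorem px_mul_px_mul_ps {i : ℕ} (hi : i + 1 < n) :
    ps n i * px n (i + 1) * px n i = px n (i + 1) * px n i * ps n i := by
  rw [← px_mul_ps hi, mul_assoc, ps_mul_px hi, artinAut_of]
  simp [px, mul_assoc]

theorem ps_commute_px {i j : ℕ} (hi : i + 1 < n) (h1 : j ≠ i) (h2 : j ≠ i + 1) :
    ps n i * px n j = px n j * ps n i := by
  rw [ps_mul_px hi, artinAut_of, if_neg h1, if_neg h2]
  rfl

theorem isBraidSeq_ps (n : ℕ) : IsBraidSeq n (ps n) := (isBraidSeq_s n).map _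

/-- The values on generators of the cocycle of the braid group on `n + 1` strands with values in
`ArtinProd n` obtained by following the position of one strand. -/
def strandVal (n i j : ℕ) : ArtinProd n :=
  if j ≤ n then
    if i + 1 = j then 1 else if i = j then px n j else if i + 1 < j then ps n i else ps n (i - 1)
  else 1

theorem strandVal_one {i j : ℕ} (h : i + 1 = j ∨ n < j) : strandVal n i j = 1 := by
  grind [strandVal]

theorem strandVal_self {i : ℕ} (h : i ≤ n) : strandVal n i i = px n i := by
  grind [strandVal]

theorem strandVal_of_lt {i j : ℕ} (h : i + 1 < j) (hj : j ≤ n) : strandVal n i j = ps n i := by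
  grind [strandVal]

theorem strandVal_of_gt {i j : ℕ} (h : j ≤ i) (hj : i + 1 ≤ n) :
    strandVal n (i + 1) j = ps n i := by
  grind [strandVal]

theorem isBraidSeq_strand (n : ℕ) :
    IsBraidSeq (n + 1) fun i => twist (sw i) (strandVal n i) where
  braid i hi := by
    have key : ∀ j, strandVal n i (sw (i + 1) (sw i j)) * strandVal n (i + 1) (sw i j) *
          strandVal n i j =
        strandVal n (i + 1) (sw i (sw (i + 1) j)) * strandVal n i (sw (i + 1) j) *
          strandVal n (i + 1) j := by
      intro j
      rcases lt_or_ge n j with h0 | h0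
      · have e1 : sw i j = j := by grind [sw_apply]
        have e2 : sw (i + 1) j = j := by grind [sw_apply]
        simp [e1, e2, strandVal_one (Or.inr h0)]
      rcases lt_or_ge j i with h1 | h1
      · have e1 : sw i j = j := by grind [sw_apply]
        have e2 : sw (i + 1) j = j := by grind [sw_apply]
        obtain ⟨k, rfl⟩ : ∃ k, i = k + 1 := ⟨i - 1, by omega⟩
        simp only [e1, e2]
        rw [strandVal_of_gt (by omega) (by omega), strandVal_of_gt (by omega) (by omega)]
        exact (isBraidSeq_ps n).braid k (by omega)
      rcases lt_or_ge (i + 2) j with h2 | h2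
      · have e1 : sw i j = j := by grind [sw_apply]
        have e2 : sw (i + 1) j = j := by grind [sw_apply]
        simp only [e1, e2]
        rw [strandVal_of_lt (by omega) (by omega), strandVal_of_lt (by omega) (by omega)]
        exact (isBraidSeq_ps n).braid i (by omega)
      obtain rfl | rfl | rfl : j = i ∨ j = i + 1 ∨ j = i + 2 := by omega
      · have e1 : sw j j = j + 1 := by grind [sw_apply]
        have e2 : sw (j + 1) (j + 1) = j + 2 := by grind [sw_apply]
        have e3 : sw (j + 1) j = j := by grind [sw_apply]
        simp only [e1, e2, e3]
        rw [strandVal_of_lt (by omega) (by omega), strandVal_self (by omega),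
          strandVal_self (by omega), strandVal_of_gt (by omega) (by omega)]
        exact px_mul_px_mul_ps (by omega)
      · have e1 : sw i (i + 1) = i := by grind [sw_apply]
        have e2 : sw (i + 1) (i + 1) = i + 2 := by grind [sw_apply]
        have e3 : sw (i + 1) i = i := by grind [sw_apply]
        have e4 : sw i (i + 2) = i + 2 := by grind [sw_apply]
        simp only [e1, e2, e3, e4]
        rw [strandVal_self (i := i) (by omega), strandVal_self (i := i + 1) (by omega),
          strandVal_of_gt (i := i) (j := i) (by omega) (by omega),
          strandVal_of_lt (i := i) (j := i + 2) (by omega) (by omega),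
          strandVal_one (i := i) (by omega), strandVal_one (i := i + 1) (by omega), mul_one,
          one_mul]
        exact px_mul_ps (by omega)
      · have e1 : sw i (i + 2) = i + 2 := by grind [sw_apply]
        have e2 : sw (i + 1) (i + 2) = i + 1 := by grind [sw_apply]
        have e3 : sw i (i + 1) = i := by grind [sw_apply]
        simp only [e1, e2, e3]
        rw [strandVal_of_lt (i := i) (j := i + 2) (by omega) (by omega),
          strandVal_of_gt (i := i) (j := i) (by omega) (by omega),
          strandVal_one (i := i) (j := i + 1) (by omega),
          strandVal_one (i := i + 1) (j := i + 2) (by omega)]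
        simp
    ext ⟨j, h⟩ : 1
    refine Prod.ext (DFunLike.congr_fun ((isBraidSeq_sw (n + 1)).braid i hi) j) ?_
    simpa [mul_assoc] using congrArg (· * h) (key j)
  comm i k hik hk := by
    have key : ∀ j, strandVal n i (sw k j) * strandVal n k j =
        strandVal n k (sw i j) * strandVal n i j := by
      intro j
      obtain ⟨k, rfl⟩ : ∃ l, k = l + 1 := ⟨k - 1, by omega⟩
      rcases lt_or_ge n j with h0 | h0
      · have e1 : sw i j = j := by grind [sw_apply]
        have e2 : sw (k + 1) j = j := by grind [sw_apply]
        simp [e1, e2, strandVal_one (Or.inr h0)]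
      rcases lt_or_ge j i with h1 | h1
      · have e1 : sw i j = j := by grind [sw_apply]
        have e2 : sw (k + 1) j = j := by grind [sw_apply]
        obtain ⟨i, rfl⟩ : ∃ k, i = k + 1 := ⟨i - 1, by omega⟩
        simp only [e1, e2]
        rw [strandVal_of_gt (by omega) (by omega), strandVal_of_gt (by omega) (by omega)]
        exact (isBraidSeq_ps n).comm i k (by omega) (by omega)
      rcases lt_or_ge (k + 2) j with h2 | h2
      · have e1 : sw i j = j := by grind [sw_apply]
        have e2 : sw (k + 1) j = j := by grind [sw_apply]
        simp only [e1, e2]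
        rw [strandVal_of_lt (by omega) (by omega), strandVal_of_lt (by omega) (by omega)]
        exact (isBraidSeq_ps n).comm i (k + 1) (by omega) (by omega)
      rcases eq_or_ne j i with rfl | h3
      · have e1 : sw j j = j + 1 := by grind [sw_apply]
        have e2 : sw (k + 1) j = j := by grind [sw_apply]
        simp only [e1, e2]
        rw [strandVal_self (by omega), strandVal_of_gt (by omega) (by omega),
          strandVal_of_gt (by omega) (by omega)]
        exact (ps_commute_px (by omega) (by omega) (by omega)).symm
      rcases eq_or_ne j (i + 1) with rfl | h4
      · have e1 : sw i (i + 1) = i := by grind [sw_apply]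
        have e2 : sw (k + 1) (i + 1) = i + 1 := by grind [sw_apply]
        simp only [e1, e2]
        rw [strandVal_one (by omega), strandVal_of_gt (by omega) (by omega),
          strandVal_of_gt (by omega) (by omega)]
        simp
      have e1 : sw i j = j := by grind [sw_apply]
      rcases eq_or_ne j (k + 1) with rfl | h5
      · have e2 : sw (k + 1) (k + 1) = k + 2 := by grind [sw_apply]
        simp only [e1, e2]
        rw [strandVal_self (by omega), strandVal_of_lt (by omega) (by omega),
          strandVal_of_lt (by omega) (by omega)]
        exact ps_commute_px (by omega) (by omega) (by omega)
      rcases eq_or_ne j (k + 2) with rfl | h6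
      · have e2 : sw (k + 1) (k + 2) = k + 1 := by grind [sw_apply]
        simp only [e1, e2]
        rw [strandVal_of_lt (i := i) (j := k + 1) (by omega) (by omega),
          strandVal_of_lt (i := i) (j := k + 2) (by omega) (by omega),
          strandVal_one (i := k + 1) (by omega)]
        simp
      have e2 : sw (k + 1) j = j := by grind [sw_apply]
      simp only [e1, e2]
      rw [strandVal_of_lt (by omega) (by omega), strandVal_of_gt (by omega) (by omega)]
      exact (isBraidSeq_ps n).comm i k (by omega) (by omega)
    ext ⟨j, h⟩ : 1
    refine Prod.ext (DFunLike.congr_fun ((isBraidSeq_sw (n + 1)).comm i k hik hk) j) ?_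
    simpa [mul_assoc] using congrArg (· * h) (key j)

/-- The element of `ArtinProd n` obtained from a braid by following the strand at `j`. -/
def strand (g : BraidGroup (n + 1)) (j : ℕ) : ArtinProd n := cocycle (isBraidSeq_strand n) g j

theorem strand_s {i : ℕ} (hi : i < n) (j : ℕ) : strand (s (n + 1) i) j = strandVal n i j :=
  cocycle_s _ (by omega) j

@[simp] theorem strand_one (j : ℕ) : strand (1 : BraidGroup (n + 1)) j = 1 := cocycle_one _ j

theorem strand_mul (x y : BraidGroup (n + 1)) (j : ℕ) :
    strand (x * y) j = strand x (perm (n + 1) y j) * strand y j :=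
  cocycle_mul _ (isBraidSeq_sw _) x y j

theorem strand_inv (x : BraidGroup (n + 1)) (j : ℕ) :
    strand x⁻¹ j = (strand x (perm (n + 1) x⁻¹ j))⁻¹ := by
  rw [eq_comm, inv_eq_iff_mul_eq_one, ← strand_mul, mul_inv_cancel, strand_one]

/-- The braid `σ_j σ_{j+1} ⋯ σ_{n-1}` on `n + 1` strands. -/
def tail (n j : ℕ) : BraidGroup (n + 1) :=
  if j < n then s (n + 1) j * tail n (j + 1) else 1
termination_by n - j

theorem tail_of_lt {j : ℕ} (h : j < n) : tail n j = s (n + 1) j * tail n (j + 1) := by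
  rw [tail, if_pos h]

@[simp] theorem tail_self (n : ℕ) : tail n n = 1 := by
  rw [tail, if_neg (lt_irrefl n)]

theorem s_commute_tail {i j : ℕ} (h : i + 1 < j) (hj : j ≤ n) :
    Commute (s (n + 1) i) (tail n j) := by
  induction hj using Nat.decreasingInduction with
  | self => simp
  | of_succ k hk ih =>
    rw [tail_of_lt hk]
    exact (commute_s (by omega) (by omega) (by omega)).mul_right (ih (by omega))

theorem s_mul_tail {i j : ℕ} (h : j ≤ i) (hi : i + 1 < n) :
    s (n + 1) (i + 1) * tail n j = tail n j * s (n + 1) i := by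
  induction h using Nat.decreasingInduction with
  | self =>
    have h1 := braid_s (n := n + 1) (i := i) (by omega)
    have h2 := s_commute_tail (n := n) (i := i) (j := i + 2) (by omega) (by omega)
    rw [tail_of_lt (by omega), tail_of_lt (by omega), ← mul_assoc, ← mul_assoc, ← h1, mul_assoc,
      h2.eq]
    simp [mul_assoc]
  | of_succ k hk ih =>
    have h1 := commute_s (n := n + 1) (i := i + 1) (j := k) (by omega) (by omega) (by omega)
    rw [tail_of_lt (by omega), ← mul_assoc, h1.eq, mul_assoc, ih, mul_assoc]

/-- The pure braid on `n + 1` strands in which the last strand winds once around strand `j`. -/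
def wind (n j : ℕ) : BraidGroup (n + 1) :=
  if j < n then (tail n (j + 1))⁻¹ * s (n + 1) j ^ 2 * tail n (j + 1) else 1

theorem wind_of_lt {j : ℕ} (h : j < n) :
    wind n j = (tail n (j + 1))⁻¹ * s (n + 1) j ^ 2 * tail n (j + 1) := if_pos h

theorem commute_wind {i j : ℕ} (hi : i + 1 < n) (h1 : j ≠ i) (h2 : j ≠ i + 1) :
    Commute (s (n + 1) i) (wind n j) := by
  rcases lt_or_ge j n with hj | hj
  swap
  · simp [wind, hj.not_gt]
  rw [wind_of_lt hj]
  rcases lt_or_gt_of_ne h1 with h | h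
  · have e1 := s_mul_tail (n := n) (i := i) (j := j + 1) (by omega) hi
    have e2 : s (n + 1) i = (tail n (j + 1))⁻¹ * s (n + 1) (i + 1) * tail n (j + 1) := by
      rw [mul_assoc, e1, inv_mul_cancel_left]
    have e3 := (commute_s (n := n + 1) (i := i + 1) (j := j) (by omega) (by omega)
      (by omega)).pow_right 2
    rw [e2, commute_iff_eq]
    have e4 := e3.eq
    simp only [mul_assoc, mul_inv_cancel_left]
    rw [← mul_assoc (s (n + 1) (i + 1)), e4, mul_assoc]
  · have e1 := s_commute_tail (n := n) (i := i) (j := j + 1) (by omega) (by omega)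
    have e2 := commute_s (n := n + 1) (i := i) (j := j) (by omega) (by omega) (by omega)
    exact (e1.inv_right.mul_right (e2.pow_right 2)).mul_right e1

theorem wind_eq {i : ℕ} (hi : i + 1 < n) :
    wind n i = (tail n (i + 2))⁻¹ * ((s (n + 1) (i + 1))⁻¹ * s (n + 1) i ^ 2 * s (n + 1) (i + 1)) *
      tail n (i + 2) := by
  rw [wind_of_lt (by omega), tail_of_lt hi]
  group

theorem s_mul_wind {i : ℕ} (hi : i + 1 < n) :
    s (n + 1) i * wind n (i + 1) = wind n i * s (n + 1) i := by
  have e1 := s_commute_tail (n := n) (i := i) (j := i + 2) (by omega) (by omega)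
  have h1 := braid_s (n := n + 1) (i := i) (by omega)
  have key : s (n + 1) i * s (n + 1) (i + 1) ^ 2 =
      (s (n + 1) (i + 1))⁻¹ * s (n + 1) i ^ 2 * s (n + 1) (i + 1) * s (n + 1) i := by
    generalize s (n + 1) i = a at *
    generalize s (n + 1) (i + 1) = b at *
    rw [mul_assoc, mul_assoc, eq_inv_mul_iff_mul_eq]
    calc b * (a * b ^ 2) = b * a * b * b := by simp only [sq, mul_assoc]
      _ = a * b * a * b := by rw [h1]
      _ = a * (b * a * b) := by simp only [mul_assoc]
      _ = a ^ 2 * (b * a) := by rw [← h1]; simp only [sq, mul_assoc]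
  rw [wind_eq hi, wind_of_lt hi, mul_assoc _ _ (s (n + 1) i), ← e1.eq, ← mul_assoc, ← mul_assoc,
    (e1.inv_right).eq, mul_assoc _ (s (n + 1) i), key]
  simp only [mul_assoc]

theorem s_mul_wind_mul_wind {i : ℕ} (hi : i + 1 < n) :
    Commute (s (n + 1) i) (wind n (i + 1) * wind n i) := by
  have e1 := s_commute_tail (n := n) (i := i) (j := i + 2) (by omega) (by omega)
  have h1 := braid_s (n := n + 1) (i := i) (by omega)
  have key : Commute (s (n + 1) i) (s (n + 1) (i + 1) * s (n + 1) i ^ 2 * s (n + 1) (i + 1)) := by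
    generalize s (n + 1) i = a at *
    generalize s (n + 1) (i + 1) = b at *
    rw [commute_iff_eq]
    calc a * (b * a ^ 2 * b) = a * b * a * (a * b) := by simp only [sq, mul_assoc]
      _ = b * a * (b * a * b) := by rw [h1]; simp only [mul_assoc]
      _ = b * a ^ 2 * b * a := by rw [← h1]; simp only [sq, mul_assoc]
  have : wind n (i + 1) * wind n i = (tail n (i + 2))⁻¹ *
      (s (n + 1) (i + 1) * s (n + 1) i ^ 2 * s (n + 1) (i + 1)) * tail n (i + 2) := by
    rw [wind_eq hi, wind_of_lt hi]
    simp only [mul_assoc, sq, mul_inv_cancel_left]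
  rw [this]
  exact (e1.inv_right.mul_right key).mul_right e1

/-- The embedding of the braid group on `n` strands into the one on `n + 1` strands. -/
def incl (n : ℕ) : BraidGroup n →* BraidGroup (n + 1) :=
  lift (s (n + 1)) ((isBraidSeq_s (n + 1)).mono n.le_succ)

theorem incl_s {i : ℕ} (hi : i + 1 < n) : incl n (s n i) = s (n + 1) i := lift_s _ _ hi

theorem lift_wind_artin (g : BraidGroup n) (x : FreeGroup ℕ) :
    FreeGroup.lift (wind n) (artin n g x) =
      incl n g * FreeGroup.lift (wind n) x * (incl n g)⁻¹ := by
  induction g using induction_on generalizing x with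
  | one => simp
  | mul a b ha hb => simp [ha, hb, mul_assoc]
  | inv a ha =>
    have := ha ((artin n a)⁻¹ x)
    rw [MulAut.apply_inv_self] at this
    rw [map_inv, map_inv, this]
    group
  | gen i hi =>
    rw [artin_s hi, incl_s hi]
    suffices (FreeGroup.lift (wind n)).comp (artinAut i).toMonoidHom =
        (MulAut.conj (s (n + 1) i)).toMonoidHom.comp (FreeGroup.lift (wind n)) from
      DFunLike.congr_fun this x
    ext j
    have e := s_mul_wind hi
    simp only [MonoidHom.comp_apply, MulEquiv.coe_toMonoidHom, artinAut_of, FreeGroup.lift_apply_of,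
      MulAut.conj_apply]
    split_ifs with h1 h2
    · subst h1
      have e2 := (s_mul_wind_mul_wind hi).eq
      rw [map_mul, map_mul, map_inv, FreeGroup.lift_apply_of, FreeGroup.lift_apply_of,
        eq_mul_inv_iff_mul_eq, mul_assoc, mul_assoc, inv_mul_eq_iff_eq_mul, ← mul_assoc, ← e2,
        ← mul_assoc, e, mul_assoc]
    · subst h2
      rw [e, FreeGroup.lift_apply_of, mul_inv_cancel_right]
    · rw [FreeGroup.lift_apply_of, (commute_wind hi h1 h2).eq, mul_inv_cancel_right]

/-- The homomorphism from `ArtinProd n` onto the stabiliser of the last strand. -/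
def unstrand (n : ℕ) : ArtinProd n →* BraidGroup (n + 1) :=
  SemidirectProduct.lift (FreeGroup.lift (wind n)) (incl n) fun g => by
    ext j
    exact lift_wind_artin g _

theorem unstrand_px (n j : ℕ) : unstrand n (px n j) = wind n j := by
  simp [unstrand, px]

theorem unstrand_ps {i : ℕ} (hi : i + 1 < n) : unstrand n (ps n i) = s (n + 1) i := by
  simp [unstrand, ps, incl_s hi]

theorem perm_wind (n j : ℕ) : perm (n + 1) (wind n j) = 1 := by
  rw [wind]
  split_ifs with h
  · simp [h, sq, sw]
  · simp

theorem perm_unstrand (x : ArtinProd n) : perm (n + 1) (unstrand n x) = perm n x.right := by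
  suffices (perm (n + 1)).comp (unstrand n) = (perm n).comp SemidirectProduct.rightHom from
    DFunLike.congr_fun this x
  apply SemidirectProduct.hom_ext
  · ext j : 1
    simp [unstrand, perm_wind]
  · refine hom_ext fun i hi => ?_
    have : i < n := by omega
    simp [unstrand, incl_s hi, hi, this]

theorem mul_tail (g : BraidGroup (n + 1)) {j : ℕ} (hj : j ≤ n) :
    g * tail n j = tail n (perm (n + 1) g j) * unstrand n (strand g j) := by
  induction g using induction_on generalizing j with
  | one => simp
  | gen i hi =>
    rw [strand_s (by omega), perm_s hi]
    rcases lt_trichotomy i j with h | rfl | h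
    · rcases eq_or_ne (i + 1) j with rfl | h1
      · have e : sw i (i + 1) = i := by grind [sw_apply]
        rw [strandVal_one (Or.inl rfl), map_one, mul_one, e, ← tail_of_lt hj]
      · have e : sw i j = j := by grind [sw_apply]
        rw [strandVal_of_lt (by omega) hj, e, unstrand_ps (by omega),
          (s_commute_tail (by omega) hj).eq]
    · have e : sw i i = i + 1 := by grind [sw_apply]
      have h : i < n := by omega
      rw [strandVal_self hj, unstrand_px, wind_of_lt h, e, tail_of_lt h, sq]
      group
    · have e : sw i j = j := by grind [sw_apply]
      obtain ⟨i, rfl⟩ : ∃ k, i = k + 1 := ⟨i - 1, by omega⟩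
      rw [strandVal_of_gt (by omega) (by omega), e, unstrand_ps (by omega),
        s_mul_tail (by omega) (by omega)]
  | mul x y hx hy =>
    have := perm_apply_lt y (Nat.lt_succ_of_le hj)
    rw [mul_assoc, hy hj, ← mul_assoc, hx (by omega), strand_mul, map_mul, map_mul, Perm.mul_apply,
      mul_assoc]
  | inv x hx =>
    have h1 := perm_apply_lt x⁻¹ (Nat.lt_succ_of_le hj)
    have h2 := hx (j := perm (n + 1) x⁻¹ j) (by omega)
    have h3 : perm (n + 1) x (perm (n + 1) x⁻¹ j) = j := by simp
    rw [h3] at h2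
    rw [strand_inv, map_inv (unstrand n), eq_mul_inv_iff_mul_eq, mul_assoc, ← h2,
      inv_mul_cancel_left]

/-- A homomorphism to the braid group fixing the last strand lifts to `ArtinProd n`. -/
theorem exists_lift_artinProd {N : Type*} [Group N] (f : N →* BraidGroup (n + 1))
    (hf : ∀ x, perm (n + 1) (f x) n = n) : ∃ F : N →* ArtinProd n, ∀ x, unstrand n (F x) = f x :=
  ⟨{ toFun x := strand (f x) n
     map_one' := by simp
     map_mul' x y := by rw [map_mul, strand_mul, hf] },
    fun x => by simpa [hf] using (mul_tail (f x) le_rfl).symm⟩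

end Artin

section FreeGroup

theorem freeGroup_of_commute {α : Type*} {a b : α}
    (h : Commute (FreeGroup.of a) (FreeGroup.of b)) : a = b := by
  classical
  by_contra hab
  have := congrArg FreeGroup.toWord h.eq
  rw [FreeGroup.toWord_mul, FreeGroup.toWord_mul] at this
  simp [FreeGroup.reduce.cons, hab] at this

theorem hom_eq_one_of_perfect {N : Type*} [Group N] (hN : commutator N = ⊤) {A : Type*}
    [CommGroup A] (f : N →* A) (x : N) : f x = 1 := by
  have := Abelianization.commutator_subset_ker f
  rw [hN] at this
  exact this trivial

theorem freeGroup_hom_eq_one_of_perfect {N : Type*} [Group N] (hN : commutator N = ⊤) {α : Type*}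
    (f : N →* FreeGroup α) (x : N) : f x = 1 := by
  have : IsEmpty (IsFreeGroup.Generators f.range) := by
    refine ⟨fun a => ?_⟩
    obtain ⟨y, hy⟩ := f.rangeRestrict_surjective (IsFreeGroup.of a)
    have h1 := hom_eq_one_of_perfect hN
      ((IsFreeGroup.lift fun _ => Multiplicative.ofAdd (1 : ℤ)).comp f.rangeRestrict) y
    rw [MonoidHom.comp_apply, hy, IsFreeGroup.lift_of] at h1
    simp at h1
  have h2 : MonoidHom.id f.range = 1 := IsFreeGroup.ext_hom fun a => isEmptyElim a
  exact congrArg Subtype.val (DFunLike.congr_fun h2 (f.rangeRestrict x))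

theorem rank_le_of_forall_exists_smul_mem {M : Type} [AddCommGroup M] (K : Submodule ℤ M)
    (h : ∀ x, ∃ m : ℕ, m ≠ 0 ∧ m • x ∈ K) : Module.rank ℤ M ≤ Module.rank ℤ K := by
  rw [← rank_quotient_add_rank_of_isDomain K, Module.rank_eq_zero_iff_isTorsion.2, zero_add]
  intro x
  induction x using Submodule.Quotient.induction_on with | H x
  obtain ⟨m, hm, hx⟩ := h x
  refine ⟨⟨m, by simpa using hm⟩, ?_⟩
  rw [← Submodule.Quotient.mk_smul, Submodule.Quotient.mk_eq_zero]
  simpa using hx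

theorem rank_le_add_rank_ker {M : Type} [AddCommGroup M] {G : Type} [Group G]
    (φ : M →+ Additive G) (r : Cardinal)
    (h : ∀ (M' : Type) [AddCommGroup M'] (f : M' →+ Additive G),
      Function.Injective f → Module.rank ℤ M' ≤ r) :
    Module.rank ℤ M ≤ r + Module.rank ℤ (AddSubgroup.toIntSubmodule φ.ker) := by
  rw [← rank_quotient_add_rank_of_isDomain (AddSubgroup.toIntSubmodule φ.ker)]
  gcongr
  exact h _ (QuotientAddGroup.kerLift φ) (QuotientAddGroup.kerLift_injective φ)

theorem rank_le_one_of_injective_freeGroup {M : Type} [AddCommGroup M] {α : Type}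
    (f : M →+ Additive (FreeGroup α)) (hf : Function.Injective f) : Module.rank ℤ M ≤ 1 := by
  let g : Multiplicative M →* FreeGroup α := AddMonoidHom.toMultiplicativeLeft f
  let e := (MonoidHom.ofInjective (f := g) hf).trans (IsFreeGroup.toFreeGroup g.range)
  have hs : Subsingleton (IsFreeGroup.Generators g.range) := by
    refine ⟨fun a b => freeGroup_of_commute ?_⟩
    rw [← e.apply_symm_apply (.of a), ← e.apply_symm_apply (.of b)]
    exact (Commute.all _ _).map e
  rcases isEmpty_or_nonempty (IsFreeGroup.Generators g.range) with he | ⟨⟨a⟩⟩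
  · have : Subsingleton M := (e.toEquiv : M ≃ _).subsingleton
    rw [rank_subsingleton']
    exact zero_le_one
  · have : Unique (IsFreeGroup.Generators g.range) := ⟨⟨a⟩, fun b => Subsingleton.elim b a⟩
    let l : M ≃+ ℤ := MulEquiv.toAdditive (e.trans FreeGroup.mulEquivIntOfUnique)
    rw [l.toIntLinearEquiv.rank_eq, Module.rank_self]

end FreeGroup

section Induction

variable {n : ℕ}

theorem eq_one_of_le_one (hn : n ≤ 1) (g : BraidGroup n) : g = 1 := by
  induction g using induction_on with
  | one => rfl
  | gen i hi => omega
  | mul x y hx hy => simp [hx, hy]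
  | inv x hx => simp [hx]

theorem exists_lift_ker (n : ℕ) : ∃ F : (perm (n + 1)).ker →* ArtinProd n,
    ∀ x, unstrand n (F x) = x :=
  exists_lift_artinProd (Subgroup.subtype _) fun x => by
    rw [Subgroup.subtype_apply, (MonoidHom.mem_ker).1 x.2, Perm.one_apply]

/-- The pure braid group is torsion free. -/
theorem eq_one_of_pow_eq_one {g : BraidGroup n} (hg : perm n g = 1) {m : ℕ} (hm : m ≠ 0)
    (h : g ^ m = 1) : g = 1 := by
  induction n with
  | zero => exact eq_one_of_le_one (by omega) g
  | succ n ih =>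
    obtain ⟨F, hF⟩ := exists_lift_ker n
    let x : (perm (n + 1)).ker := ⟨g, hg⟩
    have hx : F x ^ m = 1 := by
      rw [← map_pow, show x ^ m = 1 from Subtype.ext h, map_one]
    have h1 : (F x).right = 1 := by
      refine ih ?_ ?_
      · rw [← perm_unstrand, hF]; exact hg
      · simpa only [map_pow, map_one, SemidirectProduct.rightHom_eq_right] using
          congrArg SemidirectProduct.rightHom hx
    obtain ⟨w, hw⟩ : ∃ w, F x = SemidirectProduct.inl w :=
      ⟨(F x).left, SemidirectProduct.ext (by simp) (by simp [h1])⟩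
    have h2 : w ^ m = 1 := by
      rw [hw, ← map_pow] at hx
      exact SemidirectProduct.inl_injective (hx.trans (map_one _).symm)
    have h3 : w = 1 := (pow_eq_one_iff_left hm).1 h2
    have := hF x
    rw [hw, h3, map_one, map_one] at this
    exact this.symm

/-- Homomorphisms from a perfect group to the pure braid group are trivial. -/
theorem hom_eq_one_of_perm_eq_one {N : Type*} [Group N] (hN : commutator N = ⊤)
    (f : N →* BraidGroup n) (hf : ∀ x, perm n (f x) = 1) (x : N) : f x = 1 := by
  induction n generalizing x with
  | zero => exact eq_one_of_le_one (by omega) _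
  | succ n ih =>
    obtain ⟨F, hF⟩ := exists_lift_artinProd f fun x => by rw [hf, Perm.one_apply]
    have h1 (x) : (F x).right = 1 := by
      refine ih (SemidirectProduct.rightHom.comp F) (fun x => ?_) x
      rw [MonoidHom.comp_apply, SemidirectProduct.rightHom_eq_right, ← perm_unstrand, hF, hf]
    let G : N →* FreeGroup ℕ :=
      { toFun x := (F x).left
        map_one' := by simp
        map_mul' x y := by simp [h1] }
    have h2 : F x = 1 :=
      SemidirectProduct.ext (freeGroup_hom_eq_one_of_perfect hN G x) (h1 x)
    rw [← hF, h2, map_one]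

/-- Free abelian subgroups of the braid group on `n` strands have rank at most `n - 1`. -/
theorem rank_le_of_injective {M : Type} [AddCommGroup M] (f : M →+ Additive (BraidGroup n))
    (hf : Function.Injective f) : Module.rank ℤ M ≤ (n - 1 : ℕ) := by
  induction n generalizing M with
  | zero =>
    have : Subsingleton M := ⟨fun x y => hf ((eq_one_of_le_one (by omega) (f x).toMul).trans
      (eq_one_of_le_one (by omega) (f y).toMul).symm)⟩
    simp
  | succ n ih =>
    rcases Nat.eq_zero_or_pos n with rfl | hn
    · have : Subsingleton M := ⟨fun x y => hf ((eq_one_of_le_one (by omega) (f x).toMul).trans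
        (eq_one_of_le_one (by omega) (f y).toMul).symm)⟩
      simp
    let π : M →+ Additive (Perm (Fin (n + 1))) := (MonoidHom.toAdditive (permFin (n + 1))).comp f
    let K : Submodule ℤ M := AddSubgroup.toIntSubmodule π.ker
    have hK : Module.rank ℤ M ≤ Module.rank ℤ K := by
      refine rank_le_of_forall_exists_smul_mem K fun x =>
        ⟨orderOf (permFin (n + 1) (f x).toMul), (orderOf_pos _).ne', ?_⟩
      change π _ = 0
      rw [map_nsmul]
      exact pow_orderOf_eq_one (permFin (n + 1) (f x).toMul)
    have hp (x : K) : perm (n + 1) (f x).toMul = 1 := permFin_eq_one_iff.1 x.2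
    let fK : Multiplicative K →* BraidGroup (n + 1) :=
      AddMonoidHom.toMultiplicativeLeft (f.comp K.subtype.toAddMonoidHom)
    obtain ⟨F, hF⟩ := exists_lift_artinProd fK fun x => by
      rw [show perm (n + 1) (fK x) = 1 from hp x.toAdd, Perm.one_apply]
    let φ : K →+ Additive (BraidGroup n) :=
      MonoidHom.toAdditiveRight (SemidirectProduct.rightHom.comp F)
    have h1 : Module.rank ℤ (AddSubgroup.toIntSubmodule φ.ker) ≤ 1 := by
      have hr (x : φ.ker) : (F (.ofAdd x.1)).right = 1 := x.2
      let g : φ.ker →+ Additive (FreeGroup ℕ) :=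
        { toFun x := .ofMul (F (.ofAdd x.1)).left
          map_zero' := by simp
          map_add' x y := by simp [hr] }
      refine rank_le_one_of_injective_freeGroup g fun x y hxy => ?_
      have h2 : F (.ofAdd x.1) = F (.ofAdd y.1) :=
        SemidirectProduct.ext hxy ((hr x).trans (hr y).symm)
      have h3 : fK (.ofAdd x.1) = fK (.ofAdd y.1) := by rw [← hF, h2, hF]
      exact Subtype.ext (Subtype.ext (hf h3))
    calc Module.rank ℤ M ≤ Module.rank ℤ K := hK
      _ ≤ (n - 1 : ℕ) + 1 := (rank_le_add_rank_ker φ _ fun M' _ f' => ih f').trans (by gcongr)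
      _ = (n + 1 - 1 : ℕ) := by
        rw [← Nat.cast_succ]
        congr 1
        omega

end Induction

section JucysMurphy

variable {n : ℕ}

/-- The Jucys–Murphy braid, in which the strand at `k` winds once around all strands before it. -/
def jm (n : ℕ) : ℕ → BraidGroup n
  | 0 => 1
  | k + 1 => s n k * jm n k * s n k

theorem jm_succ (n k : ℕ) : jm n (k + 1) = s n k * jm n k * s n k := rfl

theorem commute_jm_of_lt {i k : ℕ} (h : k < i) (hi : i + 1 < n) : Commute (s n i) (jm n k) := by
  induction k with
  | zero => exact Commute.one_right _
  | succ k ih =>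
    have := commute_s (n := n) (i := i) (j := k) (by omega) hi (by omega)
    exact (this.mul_right (ih (by omega))).mul_right this

theorem commute_jm_of_gt {i k : ℕ} (h : i + 1 < k) (hk : k < n) : Commute (s n i) (jm n k) := by
  induction k, h using Nat.le_induction with
  | base =>
    have h1 := braid_s (n := n) (i := i) hk
    have h2 := (commute_jm_of_lt (n := n) (i := i + 1) (k := i) (by omega) (by omega)).eq
    rw [jm_succ, jm_succ]
    generalize s n i = a at *
    generalize s n (i + 1) = b at *
    generalize jm n i = c at *
    rw [commute_iff_eq]
    calc a * (b * (a * c * a) * b) = a * b * a * (c * a * b) := by simp only [mul_assoc]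
      _ = b * a * (b * c) * (a * b) := by rw [h1]; simp only [mul_assoc]
      _ = b * a * c * (b * a * b) := by rw [h2]; simp only [mul_assoc]
      _ = b * (a * c * a) * b * a := by rw [← h1]; simp only [mul_assoc]
  | succ k h ih =>
    have := commute_s (n := n) (i := i) (j := k) (by omega) (by omega) (by omega)
    exact (this.mul_right (ih (by omega))).mul_right this

theorem commute_jm_jm {j k : ℕ} (hj : j < n) (hk : k < n) : Commute (jm n j) (jm n k) := by
  wlog h : j ≤ k generalizing j k
  · exact (this hk hj (by omega)).symm
  rcases h.eq_or_lt with rfl | h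
  · exact Commute.refl _
  induction j with
  | zero => exact Commute.one_left _
  | succ j ih =>
    have := commute_jm_of_gt h hk
    exact (this.mul_left (ih (by omega) (by omega) (by omega))).mul_left this

theorem commute_jm_mul_jm {i : ℕ} (hi : i + 1 < n) : Commute (s n i) (jm n i * jm n (i + 1)) := by
  have h := (commute_jm_jm (n := n) (j := i) (k := i + 1) (by omega) hi).eq
  calc s n i * (jm n i * jm n (i + 1)) = jm n (i + 1) * jm n i * s n i := by
        simp only [jm_succ, mul_assoc]
    _ = jm n i * jm n (i + 1) * s n i := by rw [h]

theorem perm_jm {k : ℕ} (hk : k < n) : perm n (jm n k) = 1 := by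
  induction k with
  | zero => exact map_one _
  | succ k ih =>
    rw [jm_succ, map_mul, map_mul, ih (by omega), perm_s hk, sw]
    simp

theorem cross_jm {k : ℕ} (hk : k < n) {a b : ℕ} (hab : a ≠ b) :
    cross (jm n k) a b = if max a b = k then 1 else 0 := by
  induction k generalizing a b with
  | zero =>
    rw [jm, cross_one, if_neg (by omega)]
  | succ k ih =>
    rw [jm_succ, cross_mul, cross_mul, perm_s hk, perm_jm (by omega), cross_s hk, cross_s hk,
      ih (by omega) ((sw k).injective.ne hab)]
    simp only [Perm.one_apply, sw_apply]
    grind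

/-- The product `∏_{i < k} jm (i + 1) ^ e i`. -/
def jmProd (n : ℕ) (e : ℕ → ℤ) : ℕ → BraidGroup n
  | 0 => 1
  | k + 1 => jmProd n e k * jm n (k + 1) ^ e k

theorem jmProd_succ (e : ℕ → ℤ) (k : ℕ) :
    jmProd n e (k + 1) = jmProd n e k * jm n (k + 1) ^ e k := rfl

theorem commute_jmProd {g : BraidGroup n} {k : ℕ} (hg : ∀ i, i ≤ k → Commute g (jm n i))
    (e : ℕ → ℤ) : Commute g (jmProd n e k) := by
  induction k with
  | zero => exact Commute.one_right _
  | succ k ih => exact (ih fun i hi => hg i (by omega)).mul_right ((hg _ le_rfl).zpow_right _)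

theorem jmProd_add {k : ℕ} (hk : k < n) (e e' : ℕ → ℤ) :
    jmProd n (e + e') k = jmProd n e k * jmProd n e' k := by
  induction k with
  | zero => exact (mul_one _).symm
  | succ k ih =>
    have := commute_jmProd (g := jm n (k + 1) ^ e k) (k := k)
      (fun i hi => (commute_jm_jm hk (by omega)).zpow_left _) e'
    rw [jmProd_succ, jmProd_succ, jmProd_succ, ih (by omega), Pi.add_apply, zpow_add,
      mul_assoc, mul_assoc, ← mul_assoc (jmProd n e' k), ← this.eq, mul_assoc]

theorem perm_jmProd (e : ℕ → ℤ) {k : ℕ} (hk : k < n) : perm n (jmProd n e k) = 1 := by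
  induction k with
  | zero => exact map_one _
  | succ k ih => rw [jmProd_succ, map_mul, map_zpow, perm_jm hk, ih (by omega), one_zpow, one_mul]

theorem jmProd_congr {e e' : ℕ → ℤ} {k : ℕ} (h : ∀ i < k, e i = e' i) :
    jmProd n e k = jmProd n e' k := by
  induction k with
  | zero => rfl
  | succ k ih => rw [jmProd_succ, jmProd_succ, ih fun i hi => h i (by omega), h k (by omega)]

/-- The signed number of crossings between two strands as a homomorphism on pure braids. -/
def pureCross (n a b : ℕ) : (perm n).ker →* Multiplicative ℤ where
  toFun x := .ofAdd (cross x.1 a b)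
  map_one' := by simp
  map_mul' x y := by
    have := (MonoidHom.mem_ker).1 y.2
    simp [cross_mul, this]

theorem cross_mul_of_perm {x y : BraidGroup n} (hy : perm n y = 1) (a b : ℕ) :
    cross (x * y) a b = cross x a b + cross y a b := by
  simp [cross_mul, hy]

theorem cross_zpow {x : BraidGroup n} (hx : perm n x = 1) (m : ℤ) (a b : ℕ) :
    cross (x ^ m) a b = m * cross x a b := by
  have := congrArg Multiplicative.toAdd (map_zpow (pureCross n a b) ⟨x, hx⟩ m)
  simpa [pureCross] using this

theorem cross_jmProd (e : ℕ → ℤ) {k : ℕ} (hk : k < n) (j : ℕ) :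
    cross (jmProd n e k) 0 (j + 1) = if j < k then e j else 0 := by
  induction k with
  | zero => simp [jmProd]
  | succ k ih =>
    have h1 : perm n (jm n (k + 1) ^ e k) = 1 := by rw [map_zpow, perm_jm hk, one_zpow]
    rw [jmProd_succ, cross_mul_of_perm h1, ih (by omega), cross_zpow (perm_jm hk),
      cross_jm hk (by omega)]
    grind

end JucysMurphy

section Centre

variable {n : ℕ}

/-- The homomorphism from `ℤ ^ (n - 1)` given by the Jucys–Murphy braids. -/
def jmHom (n : ℕ) : (Fin (n - 1) → ℤ) →+ Additive (BraidGroup n) :=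
  AddMonoidHom.mk'
    (fun e => .ofMul (jmProd n (fun i => if h : i < n - 1 then e ⟨i, h⟩ else 0) (n - 1))) <| by
    intro e e'
    rcases Nat.eq_zero_or_pos n with rfl | hn
    · rfl
    rw [← ofMul_mul, ← jmProd_add (by omega)]
    congr 2
    ext i
    simp only [Pi.add_apply]
    split_ifs <;> simp

theorem jmHom_injective (n : ℕ) : Function.Injective (jmHom n) := by
  intro e e' h
  ext i
  have hi := i.2
  have h1 := congrArg (fun x => cross (Additive.toMul x) 0 (i + 1)) h
  simpa [jmHom, cross_jmProd _ (show n - 1 < n by omega)] using h1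

/-- The Garside generator of the centre of the braid group. -/
def centre (n : ℕ) : BraidGroup n := jmProd n (fun _ => 1) (n - 1)

theorem perm_centre (hn : 2 ≤ n) : perm n (centre n) = 1 := perm_jmProd _ (by omega)

theorem commute_jmProd_one {i k : ℕ} (hi : i < k) (hk : k < n) :
    Commute (s n i) (jmProd n (fun _ => 1) k) := by
  induction k with
  | zero => omega
  | succ k ih =>
    rw [jmProd_succ, zpow_one]
    rcases (Nat.lt_succ_iff.1 hi).lt_or_eq with h | rfl
    · exact (ih h (by omega)).mul_right (commute_jm_of_gt (by omega) hk)
    cases i with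
    | zero =>
      simp [jm, jmProd]
    | succ i =>
      rw [jmProd_succ, zpow_one, mul_assoc]
      exact (commute_jmProd (fun j hj => commute_jm_of_lt (by omega) hk) _).mul_right
        (commute_jm_mul_jm hk)

theorem centre_mem_center (hn : 2 ≤ n) : centre n ∈ Subgroup.center (BraidGroup n) :=
  mem_center_iff.2 fun i hi => commute_jmProd_one (by omega) (by omega)

theorem jmProd_const (hn : 2 ≤ n) (q : ℤ) : jmProd n (fun _ => q) (n - 1) = centre n ^ q := by
  suffices ∀ k < n, jmProd n (fun _ => q) k = jmProd n (fun _ => 1) k ^ q from this _ (by omega)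
  intro k hk
  induction k with
  | zero => exact (one_zpow q).symm
  | succ k ih =>
    have := commute_jmProd (g := jm n (k + 1)) (k := k)
      (fun i hi => commute_jm_jm hk (by omega)) (fun _ => 1)
    rw [jmProd_succ, jmProd_succ, zpow_one, this.symm.mul_zpow, ih (by omega)]

theorem jmHom_mem_zpowers (hn : 2 ≤ n) {e : Fin (n - 1) → ℤ}
    (h : (jmHom n e).toMul ∈ Subgroup.center (BraidGroup n)) :
    (jmHom n e).toMul ∈ Subgroup.zpowers (centre n) := by
  change jmProd n _ (n - 1) ∈ _ at h
  change jmProd n _ (n - 1) ∈ _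
  set e' : ℕ → ℤ := (fun i => if h : i < n - 1 then e ⟨i, h⟩ else 0)
  have h1 (k : ℕ) (hk : k + 2 < n) : e' (k + 1) = e' k := by
    have h2 := congrArg (fun x => cross x 0 (k + 1)) (mem_center_iff.1 h (k + 1) (by omega)).eq
    have e1 : sw (k + 1) 0 = 0 := by grind [sw_apply]
    have e2 : sw (k + 1) (k + 1) = k + 2 := by grind [sw_apply]
    have e3 : k < n - 1 := by omega
    have e4 : k + 1 < n - 1 := by omega
    simpa [cross_mul, perm_jmProd e' (show n - 1 < n by omega), hk, e1, e2, cross_s,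
      cross_jmProd e' (show n - 1 < n by omega), e3, e4] using h2.symm
  have h2 (k : ℕ) (hk : k < n - 1) : e' k = e' 0 := by
    induction k with
    | zero => rfl
    | succ k ih => rw [h1 k (by omega), ih (by omega)]
  rw [jmProd_congr h2, jmProd_const hn]
  exact Subgroup.zpow_mem_zpowers _ _

theorem exists_zpow_eq {g : (Fin (n - 1) → ℤ) →+ Additive (BraidGroup n)}
    (hg : Function.Injective g) {x : BraidGroup n} (hx : ∀ t, Commute x (g t).toMul) :
    ∃ a : ℤ, a ≠ 0 ∧ ∃ t, x ^ a = (g t).toMul := by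
  by_contra! H
  let φ : (Fin (n - 1) → ℤ) × ℤ →+ Additive (BraidGroup n) :=
    AddMonoidHom.noncommCoprod g (zmultiplesHom _ (Additive.ofMul x)) fun t a =>
      ((hx t).zpow_left a).symm
  have hφ : Function.Injective φ := by
    rw [injective_iff_map_eq_zero]
    rintro ⟨t, a⟩ h
    have h1 : (g t).toMul * x ^ a = 1 := h
    have h2 : a = 0 := by
      by_contra h2
      refine H a h2 (-t) ?_
      rw [map_neg, toMul_neg, eq_inv_iff_mul_eq_one, ((hx t).zpow_left a).eq, h1]
    rw [h2, zpow_zero, mul_one, toMul_eq_one] at h1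
    rw [h2, (injective_iff_map_eq_zero g).1 hg t h1]
    rfl
  have := rank_le_of_injective φ hφ
  rw [rank_prod', rank_fin_fun, Module.rank_self] at this
  have : (n - 1) + 1 ≤ n - 1 := by exact_mod_cast this
  omega

theorem perm_eq_one_of_mem_center (hn : 3 ≤ n) {x : BraidGroup n}
    (hx : x ∈ Subgroup.center (BraidGroup n)) : perm n x = 1 := by
  have h1 (i : ℕ) (hi : i + 1 < n) (a : ℕ) : sw i (perm n x a) = perm n x (sw i a) := by
    have := congrArg (perm n) (mem_center_iff.1 hx i hi).eq
    rw [map_mul, map_mul, perm_s hi] at this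
    exact DFunLike.congr_fun this a
  have h2 (i : ℕ) (hi : i + 1 < n) (a : ℕ) (ha : a = i ∨ a = i + 1) :
      perm n x a = i ∨ perm n x a = i + 1 := by
    have h3 := h1 i hi a
    have h4 : perm n x (sw i a) ≠ perm n x a := (perm n x).injective.ne (by grind [sw_apply])
    grind [sw_apply]
  have h3 (a : ℕ) (ha : 0 < a) (ha' : a + 1 < n) : perm n x a = a := by
    have := h2 a ha' a (Or.inl rfl)
    have := h2 (a - 1) (by omega) a (by omega)
    omega
  ext a
  rw [Perm.one_apply]
  rcases Nat.eq_zero_or_pos a with rfl | h0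
  · have h4 := h2 0 (by omega) 0 (by omega)
    have h5 := h3 1 (by omega) (by omega)
    have h6 : perm n x 0 ≠ perm n x 1 := (perm n x).injective.ne (by omega)
    omega
  rcases lt_trichotomy (a + 1) n with h | h | h
  · exact h3 a h0 h
  · have h4 := h2 (a - 1) (by omega) a (by omega)
    have h5 := h3 (a - 1) (by omega) (by omega)
    have h6 : perm n x a ≠ perm n x (a - 1) := (perm n x).injective.ne (by omega)
    omega
  · exact perm_apply_of_le x (by omega)

theorem eq_one_of_zpow_eq_one {g : BraidGroup n} (hg : perm n g = 1) {m : ℤ} (hm : m ≠ 0)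
    (h : g ^ m = 1) : g = 1 := by
  refine eq_one_of_pow_eq_one hg (Int.natAbs_ne_zero.2 hm) ?_
  rcases Int.natAbs_eq m with h1 | h1
  · rwa [h1, zpow_natCast] at h
  · rwa [h1, zpow_neg, inv_eq_one, zpow_natCast] at h

theorem mem_zpowers_of_mem_center (hn : 3 ≤ n) {x : BraidGroup n}
    (hx : x ∈ Subgroup.center (BraidGroup n)) : x ∈ Subgroup.zpowers (centre n) := by
  have hp := perm_eq_one_of_mem_center hn hx
  have hz := perm_centre (n := n) (by omega)
  obtain ⟨b, hb, t, ht⟩ := exists_zpow_eq (jmHom_injective n)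
    fun t => (Subgroup.mem_center_iff.1 hx _).symm
  obtain ⟨r, hr⟩ := jmHom_mem_zpowers (e := t) (by omega) (ht ▸ zpow_mem hx b)
  have hr : x ^ b = centre n ^ r := ht.trans hr.symm
  have hc : cross (centre n) 0 1 = 1 := by
    have h1 : 0 < n - 1 := by omega
    rw [centre, cross_jmProd _ (by omega) 0, if_pos h1]
  have hq := cross_zpow hp b 0 1
  rw [hr, cross_zpow hz, hc, mul_one] at hq
  refine ⟨cross x 0 1, ?_⟩
  have hcomm : Commute x (centre n ^ cross x 0 1)⁻¹ := (Subgroup.mem_center_iff.1 hx _).symm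
  refine (eq_of_mul_inv_eq_one (eq_one_of_zpow_eq_one ?_ hb ?_)).symm
  · rw [map_mul, map_inv, map_zpow, hp, hz]
    simp
  · rw [hcomm.mul_zpow, hr, hq, inv_zpow, ← zpow_mul, mul_comm b, mul_inv_cancel]

/-- The abelianisation of the braid group. -/
def len (n : ℕ) : BraidGroup n →* Multiplicative ℤ :=
  lift (fun _ => .ofAdd 1) ⟨fun _ _ => rfl, fun _ _ _ _ => rfl⟩

theorem len_s {i : ℕ} (hi : i + 1 < n) : len n (s n i) = .ofAdd 1 := lift_s _ _ hi

theorem len_jm {k : ℕ} (hk : k < n) : (len n (jm n k)).toAdd = 2 * k := by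
  induction k with
  | zero => simp [jm]
  | succ k ih =>
    rw [jm_succ, map_mul (len n), map_mul (len n), len_s hk, toAdd_mul, toAdd_mul,
      ih (by omega), toAdd_ofAdd]
    push_cast
    ring

theorem len_jmProd_one {k : ℕ} (hk : k < n) :
    (len n (jmProd n (fun _ => 1) k)).toAdd = k * (k + 1) := by
  induction k with
  | zero => simp [jmProd]
  | succ k ih =>
    rw [jmProd_succ, zpow_one, map_mul, toAdd_mul, len_jm hk, ih (by omega)]
    push_cast
    ring

theorem hom_eq_zpow_len {A : Type*} [CommGroup A] (ψ : BraidGroup n →* A) (g : BraidGroup n) :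
    ψ g = ψ (s n 0) ^ (len n g).toAdd := by
  have h (i : ℕ) (hi : i + 1 < n) : ψ (s n i) = ψ (s n 0) := by
    induction i with
    | zero => rfl
    | succ i ih =>
      rw [← ih (by omega)]
      have := congrArg ψ (braid_s (n := n) (i := i) hi)
      simp only [map_mul] at this
      rw [mul_comm (ψ (s n i)), mul_left_cancel_iff] at this
      exact this.symm
  suffices ψ = (zpowersHom A (ψ (s n 0))).comp (len n) from DFunLike.congr_fun this g
  refine hom_ext fun i hi => ?_
  simp [len_s hi, h i hi]

end Centre

section FullTwist

variable {n : ℕ}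

/-- The braid `σ_0 σ_1 ⋯ σ_{k-1}`. -/
def dl (n : ℕ) : ℕ → BraidGroup n
  | 0 => 1
  | k + 1 => dl n k * s n k

theorem dl_succ (n k : ℕ) : dl n (k + 1) = dl n k * s n k := rfl

theorem braidδ_eq_dl (n : ℕ) : braidδ n = dl n (n - 1) := by
  have h : braidσ n = fun i : Fin (n - 1) => s n i := by
    ext i
    rw [s_of_lt i.2]
    rfl
  rw [braidδ, h]
  suffices ∀ m, (List.ofFn fun i : Fin m => s n i).prod = dl n m from this _
  intro m
  induction m with
  | zero => simp [dl]
  | succ m ih =>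
    rw [List.ofFn_succ', List.prod_concat, dl_succ, ← ih]
    simp

theorem commute_s_dl {i k : ℕ} (h : k < i) (hi : i + 1 < n) : Commute (s n i) (dl n k) := by
  induction k with
  | zero => exact Commute.one_right _
  | succ k ih => exact (ih (by omega)).mul_right (commute_s (by omega) hi (by omega))

theorem dl_semiconj {i k : ℕ} (h : i + 1 < k) (hk : k < n) :
    SemiconjBy (dl n k) (s n i) (s n (i + 1)) := by
  induction k, h using Nat.le_induction with
  | base =>
    have h1 := (commute_s_dl (n := n) (i := i + 1) (k := i) (by omega) hk).eq
    have h2 := braid_s (n := n) (i := i) hk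
    calc dl n i * s n i * s n (i + 1) * s n i
        = dl n i * (s n i * s n (i + 1) * s n i) := by simp only [mul_assoc]
      _ = dl n i * s n (i + 1) * (s n i * s n (i + 1)) := by rw [h2]; simp only [mul_assoc]
      _ = s n (i + 1) * (dl n i * s n i * s n (i + 1)) := by rw [← h1]; simp only [mul_assoc]
  | succ k h ih =>
    exact (ih (by omega)).mul_left (commute_s (n := n) (i := k) (j := i) (by omega) hk (by omega))

theorem dl_sq_semiconj {k : ℕ} (hk : k + 1 < n) :
    SemiconjBy (dl n (k + 1) ^ 2) (s n k) (s n 0) := by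
  induction k with
  | zero =>
    simp only [dl, one_mul]
    exact (Commute.refl _).pow_left 2
  | succ k ih =>
    have h1 := (commute_s_dl (n := n) (i := k + 1) (k := k) (by omega) hk).eq
    have h2 := braid_s (n := n) (i := k) hk
    have h3 : dl n (k + 1 + 1) ^ 2 = dl n (k + 1) ^ 2 * (s n (k + 1) * s n k) := by
      rw [sq, sq, dl_succ n (k + 1)]
      calc dl n (k + 1) * s n (k + 1) * (dl n (k + 1) * s n (k + 1))
          = dl n (k + 1) * (s n (k + 1) * dl n k) * (s n k * s n (k + 1)) := by
            rw [dl_succ n k]; simp only [mul_assoc]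
        _ = dl n (k + 1) * dl n k * (s n (k + 1) * s n k * s n (k + 1)) := by
            rw [h1]; simp only [mul_assoc]
        _ = dl n (k + 1) * dl n (k + 1) * (s n (k + 1) * s n k) := by
            rw [← h2, dl_succ n k]; simp only [mul_assoc]
    have h4 := (ih (by omega)).eq
    rw [h3, SemiconjBy]
    calc dl n (k + 1) ^ 2 * (s n (k + 1) * s n k) * s n (k + 1)
        = dl n (k + 1) ^ 2 * s n k * (s n (k + 1) * s n k) := by
          rw [mul_assoc, ← h2]; simp only [mul_assoc]
      _ = s n 0 * (dl n (k + 1) ^ 2 * (s n (k + 1) * s n k)) := by rw [h4, mul_assoc]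

theorem fullTwist_mem_center (hn : 2 ≤ n) : fullTwist n ∈ Subgroup.center (BraidGroup n) := by
  rw [fullTwist, braidδ_eq_dl, mem_center_iff]
  obtain ⟨m, rfl⟩ : ∃ m, n = m + 2 := ⟨n - 2, by omega⟩
  change ∀ i, _ → Commute _ (dl (m + 2) (m + 1) ^ (m + 2))
  have key (i d : ℕ) (h : i + d ≤ m) :
      SemiconjBy (dl (m + 2) (m + 1) ^ d) (s _ i) (s _ (i + d)) := by
    induction d with
    | zero => rw [pow_zero]; exact SemiconjBy.one_left _
    | succ d ih =>
      rw [pow_succ']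
      exact (dl_semiconj (i := i + d) (by omega) (by omega)).mul_left (ih (by omega))
  intro i hi
  have h1 := key i (m - i) (by omega)
  have h2 := dl_sq_semiconj (n := m + 2) (k := m) (by omega)
  have h3 := key 0 i (by omega)
  rw [Nat.add_sub_cancel' (by omega)] at h1
  rw [zero_add] at h3
  have h4 := h3.mul_left (h2.mul_left h1)
  rw [← pow_add, ← pow_add, show i + (2 + (m - i)) = m + 2 by omega] at h4
  exact Commute.symm h4

end FullTwist

section Collapse

variable {n : ℕ} {G : Type*} [Group G]

theorem eq_of_commute (φ : BraidGroup n →* G) {i : ℕ} (hi : i + 2 < n)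
    (h : Commute (φ (s n i)) (φ (s n (i + 1)))) : φ (s n i) = φ (s n (i + 1)) := by
  have := congrArg φ (braid_s hi)
  simp only [map_mul] at this
  rwa [h.eq, mul_assoc, mul_assoc, mul_left_cancel_iff, h.eq, mul_left_inj] at this

/-- If two adjacent generators have the same image then so do all generators. -/
theorem eq_succ_of_eq_succ (φ : BraidGroup n →* G) {i j : ℕ} (hi : i + 2 < n) (hj : j + 2 < n)
    (h : φ (s n i) = φ (s n (i + 1))) : φ (s n j) = φ (s n (j + 1)) := by
  have key (k : ℕ) (hk : k + 3 < n) : φ (s n k) = φ (s n (k + 1)) ↔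
      φ (s n (k + 1)) = φ (s n (k + 2)) := by
    have h1 := ((dl_semiconj (n := n) (i := k) (k := n - 1) (by omega) (by omega)).map φ).eq
    have h2 := ((dl_semiconj (n := n) (i := k + 1) (k := n - 1) (by omega) (by omega)).map φ).eq
    refine ⟨fun h => ?_, fun h => ?_⟩
    · rwa [h, h2, mul_left_inj, eq_comm] at h1
    · rwa [← h, ← h1, mul_right_inj, eq_comm] at h2
  have key0 (k : ℕ) (hk : k + 2 < n) : φ (s n 0) = φ (s n 1) ↔ φ (s n k) = φ (s n (k + 1)) := by
    induction k with
    | zero => rfl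
    | succ k ih => rw [ih (by omega), key k (by omega)]
  rwa [← key0 j hj, key0 i hi]

theorem eq_of_eq_succ (φ : BraidGroup n →* G) (h : φ (s n 0) = φ (s n 1)) {i : ℕ}
    (hi : i + 1 < n) : φ (s n i) = φ (s n 0) := by
  induction i with
  | zero => rfl
  | succ i ih =>
    rw [← eq_succ_of_eq_succ φ (i := 0) (by omega) hi h, ih (by omega)]

theorem eq_of_commute_quotients (hn : 5 ≤ n) (φ : BraidGroup n →* G)
    (h : Commute (φ (s n 0 * (s n 3)⁻¹)) (φ (s n 1 * (s n 3)⁻¹))) : φ (s n 0) = φ (s n 1) := by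
  refine eq_of_commute φ (by omega) ?_
  have h0 : Commute (φ (s n 0)) (φ (s n 3)) :=
    (commute_s (by omega) (by omega) (by omega)).map φ
  have h1 : Commute (φ (s n 1)) (φ (s n 3)) :=
    (commute_s (by omega) (by omega) (by omega)).map φ
  rw [map_mul, map_mul, map_inv] at h
  have h2 := (h0.mul_left (Commute.refl _).inv_left : Commute (φ (s n 0) * (φ (s n 3))⁻¹) _)
  have h3 := (h1.mul_left (Commute.refl _).inv_left : Commute (φ (s n 1) * (φ (s n 3))⁻¹) _)
  simpa using (h.mul_right h2).mul_left (h3.symm.mul_right (Commute.refl _))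

theorem map_commutator_eq_one (φ : BraidGroup n →* G) (h : φ (s n 0) = φ (s n 1))
    {x : BraidGroup n} (hx : x ∈ commutator (BraidGroup n)) : φ x = 1 := by
  have h1 : φ = (zpowersHom G (φ (s n 0))).comp (len n) :=
    hom_ext fun i hi => by simp [len_s hi, eq_of_eq_succ φ h hi]
  have h2 := Abelianization.commutator_subset_ker (len n) hx
  rw [MonoidHom.mem_ker] at h2
  rw [h1, MonoidHom.comp_apply, h2, map_one]

theorem mul_inv_mem_commutator {i j : ℕ} (hi : i + 1 < n) (hj : j + 1 < n) :
    s n i * (s n j)⁻¹ ∈ commutator (BraidGroup n) := by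
  rw [← Abelianization.ker_of, MonoidHom.mem_ker, map_mul, map_inv, hom_eq_zpow_len _ (s n i),
    hom_eq_zpow_len _ (s n j), len_s hi, len_s hj, mul_inv_cancel]

/-- The commutator subgroup of the braid group on at least five strands is perfect. -/
theorem commutator_perfect (hn : 5 ≤ n) : commutator (commutator (BraidGroup n)) = ⊤ := by
  set N := commutator (BraidGroup n)
  have h1 : N ≤ ⁅N, N⁆ := by
    intro x hx
    rw [← QuotientGroup.eq_one_iff]
    refine map_commutator_eq_one (QuotientGroup.mk' ⁅N, N⁆) ?_ hx
    refine eq_of_commute_quotients hn _ ?_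
    rw [← commutatorElement_eq_one_iff_commute, ← map_commutatorElement]
    refine (QuotientGroup.eq_one_iff _).2 (Subgroup.commutator_mem_commutator ?_ ?_) <;>
      exact mul_inv_mem_commutator (by omega) (by omega)
  rw [eq_top_iff]
  intro x _
  have h2 := h1 x.2
  rw [← Subgroup.map_subtype_commutator] at h2
  obtain ⟨y, hy, hyx⟩ := h2
  rwa [← Subtype.ext hyx]

end Collapse

section SmallDegree

variable {n : ℕ}

/-- Every action of the braid group on at most `m` points identifies the generators. -/
def SmallActionsCyclic (n m : ℕ) : Prop :=
  ∀ (α : Type) [Finite α], Nat.card α ≤ m → ∀ φ : BraidGroup n →* Perm α, φ (s n 0) = φ (s n 1)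

theorem map_mul_inv_eq_one {G : Type*} [Group G] (φ : BraidGroup n →* G)
    (h : φ (s n 0) = φ (s n 1)) {i j : ℕ} (hi : i + 1 < n) (hj : j + 1 < n) :
    φ (s n i * (s n j)⁻¹) = 1 :=
  map_commutator_eq_one φ h (mul_inv_mem_commutator hi hj)

section Centralizer

variable {G α : Type*} [Group G] {τ : Perm α} (φ : G →* Perm α) (h : ∀ g, Commute τ (φ g))

theorem apply_comm_of_commute {σ τ : Perm α} (h : Commute τ σ) (x : α) : τ (σ x) = σ (τ x) :=
  Equiv.ext_iff.1 h.eq x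

/-- The action on the fixed points of a permutation commuting with the given action. -/
def fixedHom : G →* Perm {x // τ x = x} :=
  MonoidHom.mk' (fun g => (φ g).subtypePerm fun x => by
    rw [apply_comm_of_commute (h g), (φ g).injective.eq_iff]) fun a b => by
      ext x
      simp [map_mul]
      rfl

/-- The action on the moved points of a permutation commuting with the given action. -/
def movedHom : G →* Perm {x // τ x ≠ x} :=
  MonoidHom.mk' (fun g => (φ g).subtypePerm fun x => by
    rw [ne_eq, apply_comm_of_commute (h g), (φ g).injective.eq_iff]) fun a b => by
      ext x
      simp [map_mul]
      rfl

/-- The equivalence relation of lying in the same nontrivial cycle. -/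
def movedSetoid (τ : Perm α) : Setoid {x // τ x ≠ x} := (Equiv.Perm.SameCycle.setoid τ).comap (↑)

theorem sameCycle_iff_of_commute {σ τ : Perm α} (h : Commute τ σ) (x y : α) :
    τ.SameCycle x y ↔ τ.SameCycle (σ x) (σ y) := by
  have h1 : σ * τ * σ⁻¹ = τ := by rw [← h.eq, mul_inv_cancel_right]
  conv_rhs => rw [← h1, Equiv.Perm.sameCycle_conj]
  simp

/-- The action on the nontrivial cycles of a permutation commuting with the given action. -/
def cyclesHom : G →* Perm (Quotient (movedSetoid τ)) :=
  MonoidHom.mk' (fun g => Quotient.congr (movedHom φ h g) fun x y =>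
    sameCycle_iff_of_commute (h g) x y) fun a b => by
      ext x
      induction x using Quotient.inductionOn with
      | h x =>
        simp [Quotient.congr_mk]
        rfl

theorem two_mul_card_cycles_le [Finite α] (τ : Perm α) :
    2 * Nat.card (Quotient (movedSetoid τ)) ≤ Nat.card {x // τ x ≠ x} := by
  let f : Quotient (movedSetoid τ) × Bool → {x // τ x ≠ x} := fun p =>
    if p.2 then ⟨τ p.1.out, by simpa using p.1.out.2⟩ else p.1.out
  have hmk (p) : ⟦f p⟧ = p.1 := by
    obtain ⟨q, b⟩ := p
    cases b
    · simp [f]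
    · refine (Quotient.sound ?_).trans q.out_eq
      change τ.SameCycle (τ q.out) q.out
      simpa using Equiv.Perm.SameCycle.refl τ _
  have hf : Function.Injective f := by
    intro p q hpq
    have h1 : p.1 = q.1 := by rw [← hmk, hpq, hmk]
    obtain ⟨p, b⟩ := p
    obtain ⟨q, c⟩ := q
    obtain rfl : p = q := h1
    have h2 := p.out.2
    cases b <;> cases c <;> simp [f, Subtype.ext_iff] at hpq ⊢
    · exact h2 hpq.symm
    · exact h2 hpq
  have := Nat.card_le_card_of_injective f hf
  rwa [Nat.card_prod, Nat.card_eq_fintype_card (α := Bool), Fintype.card_bool, mul_comm] at this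

theorem card_fixed_add_card_moved [Finite α] (τ : Perm α) :
    Nat.card {x // τ x = x} + Nat.card {x // τ x ≠ x} = Nat.card α := by
  classical
  rw [← Nat.card_sum]
  exact Nat.card_congr (Equiv.sumCompl fun x => τ x = x)

end Centralizer

theorem eq_of_commute_perm (hn : 5 ≤ n) {m : ℕ} (hP : SmallActionsCyclic n m) {α : Type} [Finite α]
    {τ : Perm α} (φ : BraidGroup n →* Perm α) (h : ∀ g, Commute τ (φ g))
    (hfix : Nat.card {x // τ x = x} ≤ m) (hmoved : Nat.card {x // τ x ≠ x} ≤ 2 * m + 1) :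
    φ (s n 0) = φ (s n 1) := by
  have h0 := hP _ hfix (fixedHom φ h)
  have h1 := hP _ (by have := two_mul_card_cycles_le τ; omega) (cyclesHom φ h)
  have key {i j : ℕ} (hi : i + 1 < n) (hj : j + 1 < n) (x : α) :
      (τ x = x → φ (s n i * (s n j)⁻¹) x = x) ∧ τ.SameCycle x (φ (s n i * (s n j)⁻¹) x) := by
    have h0 := map_mul_inv_eq_one _ h0 hi hj
    have h1 := map_mul_inv_eq_one _ h1 hi hj
    generalize s n i * (s n j)⁻¹ = y at *
    have hx (hx : τ x = x) : φ y x = x := congrArg Subtype.val (Equiv.ext_iff.1 h0 ⟨x, hx⟩)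
    refine ⟨hx, ?_⟩
    by_cases hτ : τ x = x
    · rw [hx hτ]
    · have h2 := Equiv.ext_iff.1 h1 ⟦⟨x, hτ⟩⟧
      exact Equiv.Perm.SameCycle.symm (Quotient.exact h2)
  refine eq_of_commute_quotients hn φ ?_
  have k0 := fun x => (key (i := 0) (j := 3) (by omega) (by omega) x).2
  have k1 := fun x => (key (i := 1) (j := 3) (by omega) (by omega) x).2
  have c0 := h (s n 0 * (s n 3)⁻¹)
  have c1 := h (s n 1 * (s n 3)⁻¹)
  generalize φ (s n 0 * (s n 3)⁻¹) = y at *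
  generalize φ (s n 1 * (s n 3)⁻¹) = z at *
  ext x
  obtain ⟨a, ha⟩ := k0 x
  obtain ⟨b, hb⟩ := k1 x
  rw [Equiv.Perm.mul_apply, Equiv.Perm.mul_apply, ← ha, ← hb,
    ← apply_comm_of_commute (c0.zpow_left b), ← apply_comm_of_commute (c1.zpow_left a), ← ha, ← hb,
    ← Equiv.Perm.mul_apply, ← Equiv.Perm.mul_apply, ← zpow_add, ← zpow_add, add_comm]

theorem smallActionsCyclic_three (hn : 5 ≤ n) : SmallActionsCyclic n 3 := by
  intro α _ hα φ
  have e : α ↪ Fin 3 := by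
    have := Fintype.ofFinite α
    refine Function.Embedding.trans (Fintype.equivFin α).toEmbedding (Fin.castLEEmb ?_)
    rwa [← Nat.card_eq_fintype_card]
  apply Equiv.Perm.viaEmbeddingHom_injective e
  change ((Equiv.Perm.viaEmbeddingHom e).comp φ) _ = ((Equiv.Perm.viaEmbeddingHom e).comp φ) _
  generalize (Equiv.Perm.viaEmbeddingHom e).comp φ = φ
  refine eq_of_commute_quotients hn φ ?_
  have h1 {i j : ℕ} (hi : i + 1 < n) (hj : j + 1 < n) :
      Equiv.Perm.sign (φ (s n i * (s n j)⁻¹)) = 1 := by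
    change (Equiv.Perm.sign.comp φ) _ = 1
    rw [map_mul, map_inv, hom_eq_zpow_len _ (s n i), hom_eq_zpow_len _ (s n j), len_s hi, len_s hj,
      mul_inv_cancel]
  have h2 : ∀ a b : Perm (Fin 3), Equiv.Perm.sign a = 1 → Equiv.Perm.sign b = 1 →
      a * b = b * a := by
    decide
  exact h2 _ _ (h1 (by omega) (by omega)) (h1 (by omega) (by omega))

theorem SmallActionsCyclic.mono {m k : ℕ} (h : SmallActionsCyclic n m) (hk : k ≤ m) :
    SmallActionsCyclic n k := fun α _ hα => h α (hα.trans hk)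

theorem two_le_card_moved {α : Type*} [Finite α] {τ : Perm α} (h : τ ≠ 1) :
    2 ≤ Nat.card {x // τ x ≠ x} := by
  obtain ⟨x, hx⟩ : ∃ x, τ x ≠ x := by
    by_contra! h1
    exact h (Equiv.ext h1)
  have : Nontrivial {x // τ x ≠ x} := ⟨⟨x, hx⟩, ⟨τ x, by simpa using hx⟩, by simpa using hx.symm⟩
  exact Finite.one_lt_card

theorem three_le_card_moved {α : Type*} [Finite α] {τ : Perm α} (h : τ ^ 2 ≠ 1) :
    3 ≤ Nat.card {x // τ x ≠ x} := by
  obtain ⟨x, hx⟩ : ∃ x, τ (τ x) ≠ x := by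
    by_contra! h1
    exact h (Equiv.ext fun x => by simpa [sq] using h1 x)
  have hx1 : τ x ≠ x := fun h => hx (by rw [h, h])
  have hf : Function.Injective
      (![⟨x, hx1⟩, ⟨τ x, by simpa using hx1⟩, ⟨τ (τ x), by simpa using hx1⟩] :
        Fin 3 → {x // τ x ≠ x}) := by
    intro i j hij
    fin_cases i <;> fin_cases j <;> simp [hx1, hx, hx1.symm, hx.symm] at hij ⊢
  simpa using Nat.card_le_card_of_injective _ hf

/-- For `n ≥ 5`, an action of the braid group on at most `n - 3` points is cyclic. -/
theorem smallActionsCyclic (hn : 5 ≤ n) : SmallActionsCyclic n (n - 3) := by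
  induction n using Nat.strong_induction_on with
  | h n ih =>
  obtain hn7 | hn7 := lt_or_ge n 7
  · exact (smallActionsCyclic_three hn).mono (by omega)
  intro α _ hα φ
  by_cases hτ : φ (s n 0) = 1
  · have := congrArg φ (braid_s (n := n) (i := 0) (by omega))
    simp only [map_mul, hτ, one_mul, mul_one] at this
    rw [hτ, eq_comm]
    simpa using this
  obtain ⟨k, rfl⟩ : ∃ k, n = k + 2 := ⟨n - 2, by omega⟩
  let sh : BraidGroup k →* BraidGroup (k + 2) := lift (fun i => s (k + 2) (i + 2))
    ⟨fun i hi => braid_s (by omega), fun i j hij hj =>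
      (commute_s (by omega) (by omega) (by omega)).eq⟩
  have hsh {i : ℕ} (hi : i + 1 < k) : sh (s k i) = s (k + 2) (i + 2) := lift_s _ _ hi
  have hc (g : BraidGroup k) : Commute (s (k + 2) 0) (sh g) := by
    induction g using induction_on with
    | one => rw [map_one]; exact Commute.one_right _
    | gen i hi => rw [hsh hi]; exact commute_s (by omega) (by omega) (by omega)
    | mul x y hx hy => rw [map_mul]; exact hx.mul_right hy
    | inv x hx => rw [map_inv]; exact hx.inv_right
  have h1 := two_le_card_moved hτ
  have h2 := card_fixed_add_card_moved (φ (s (k + 2) 0))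
  have h3 := eq_of_commute_perm (by omega) (ih k (by omega) (by omega)) (φ.comp sh)
    (fun g => (hc g).map φ) (by omega) (by omega)
  rw [MonoidHom.comp_apply, MonoidHom.comp_apply, hsh (by omega), hsh (by omega)] at h3
  exact eq_succ_of_eq_succ φ (i := 2) (j := 0) (by omega) (by omega) h3

end SmallDegree

section Main

variable {n : ℕ} {ρ : BraidGroup n →* BraidGroup n}

theorem len_centre (hn : 2 ≤ n) : (len n (centre n)).toAdd ≠ 0 := by
  rw [centre, len_jmProd_one (by omega)]
  have h1 : (0 : ℤ) < ((n - 1 : ℕ) : ℤ) := by omega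
  positivity

theorem exists_map_centre_zpow (hn : 2 ≤ n) (hρ : Function.Injective ρ) :
    ∃ a q : ℤ, q ≠ 0 ∧ ρ (centre n) ^ q = centre n ^ a := by
  have hc := Subgroup.mem_center_iff.1 (centre_mem_center hn)
  obtain ⟨a, ha, t, ht⟩ := exists_zpow_eq (g := (MonoidHom.toAdditive ρ).comp (jmHom n))
    (fun x y h => jmHom_injective n (hρ h)) (x := centre n) (fun t => (hc _).symm)
  change _ = ρ (jmHom n t).toMul at ht
  have h1 : (jmHom n t).toMul ∈ Subgroup.center (BraidGroup n) := by
    refine Subgroup.mem_center_iff.2 fun g => hρ ?_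
    rw [map_mul, map_mul, ← ht]
    exact (Commute.zpow_right (hc (ρ g)) a : Commute _ _)
  obtain ⟨q, hq⟩ := jmHom_mem_zpowers hn h1
  change centre n ^ q = _ at hq
  rw [← hq, map_zpow] at ht
  refine ⟨a, q, ?_, ht.symm⟩
  rintro rfl
  have h2 := congrArg (fun g => (len n g).toAdd) ht
  simp [len_centre hn, ha] at h2

/-- If `ρ` is injective then `ρ (centre n)` is a power of `centre n`, up to an element of finite
order which commutes with the image of `ρ`. -/
theorem exists_finite_order (hn : 2 ≤ n) (hρ : Function.Injective ρ) :
    ∃ c q : ℤ, q ≠ 0 ∧ (ρ (centre n) * (centre n ^ c)⁻¹) ^ q = 1 := by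
  obtain ⟨a, q, hq, h⟩ := exists_map_centre_zpow hn hρ
  have hlen := congrArg (fun g => (len n g).toAdd) h
  have h1 := congrArg Multiplicative.toAdd (hom_eq_zpow_len ((len n).comp ρ) (centre n))
  set c := (len n (ρ (s n 0))).toAdd
  simp only [MonoidHom.comp_apply, map_zpow, toAdd_zpow, smul_eq_mul] at hlen h1
  refine ⟨c, q, hq, ?_⟩
  have h2 : a = q * c := by
    rw [h1] at hlen
    refine mul_right_cancel₀ (len_centre hn) ?_
    rw [← hlen]
    ring
  have hc : Commute (ρ (centre n)) (centre n) :=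
    Subgroup.mem_center_iff.1 (centre_mem_center hn) _
  rw [(hc.zpow_right c).inv_right.mul_zpow, h, inv_zpow, ← zpow_mul, h2, mul_comm q, mul_inv_cancel]

theorem permFin_sq_ne_one {u : BraidGroup n} {q : ℤ} (hq : q ≠ 0) (hu : u ^ q = 1)
    (h : permFin n u ≠ 1) : permFin n u ^ 2 ≠ 1 := by
  intro h1
  rw [← map_pow, permFin_eq_one_iff] at h1
  refine h (permFin_eq_one_iff.2 (perm_eq_one_of_sq_eq_one (eq_one_of_zpow_eq_one h1 hq ?_)))
  rw [← zpow_natCast, ← zpow_mul, mul_comm, zpow_mul, hu, one_zpow]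

/-- A braid of finite order commuting with the image of an injective endomorphism is pure. -/
theorem permFin_eq_one_of_commute (hn : 5 ≤ n) (hρ : Function.Injective ρ) {u : BraidGroup n}
    {q : ℤ} (hq : q ≠ 0) (hu : u ^ q = 1) (h : ∀ g, Commute u (ρ g)) : permFin n u = 1 := by
  by_contra hτ
  have h1 := three_le_card_moved (permFin_sq_ne_one hq hu hτ)
  have h2 := card_fixed_add_card_moved (permFin n u)
  rw [Nat.card_fin] at h2
  have h3 := eq_of_commute_perm hn (smallActionsCyclic hn) ((permFin n).comp ρ)
    (fun g => (h g).map (permFin n)) (by omega) (by omega)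
  have h4 := hom_eq_one_of_perm_eq_one (commutator_perfect hn)
    (ρ.comp (commutator (BraidGroup n)).subtype)
    (fun x => permFin_eq_one_iff.1 (map_commutator_eq_one _ h3 x.2))
    ⟨s n 0 * (s n 1)⁻¹, mul_inv_mem_commutator (by omega) (by omega)⟩
  have h5 : s n 0 = s n 1 := mul_inv_eq_one.1 (hρ (h4.trans (map_one ρ).symm))
  have h6 := congrArg (fun g => perm n g 0) h5
  simp only [perm_s (show 0 + 1 < n by omega), perm_s (show 1 + 1 < n by omega)] at h6
  simp [sw_apply] at h6

set_option maxRecDepth 100000 in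
theorem permFin_four_map_centre {ρ : BraidGroup 4 →* BraidGroup 4} {u : BraidGroup 4}
    {q : ℤ} (hq : q ≠ 0) (hu : u ^ q = 1) (h : ∀ g, Commute u (ρ g)) (hτ : permFin 4 u ≠ 1) :
    permFin 4 (ρ (centre 4)) = 1 := by
  have h1 := permFin_sq_ne_one hq hu hτ
  have h2 : permFin 4 u ^ 4 ≠ 1 := by
    have h3 := permFin_sq_ne_one (u := u ^ 2) hq
      (by rw [← zpow_natCast, ← zpow_mul, mul_comm, zpow_mul, hu, one_zpow]) (by rwa [map_pow])
    rwa [map_pow, ← pow_mul] at h3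
  have key : ∀ τ : Perm (Fin 4), τ ^ 4 ≠ 1 → ∀ σ, τ * σ = σ * τ → σ = 1 ∨ σ = τ ∨ σ = τ ^ 2 := by
    decide
  have key3 : ∀ τ : Perm (Fin 4), τ ^ 4 ≠ 1 → τ ^ 12 = 1 := by
    decide
  have hmem (g : BraidGroup 4) : permFin 4 (ρ g) ∈ Subgroup.zpowers (permFin 4 u) := by
    rcases key _ h2 _ ((h g).map (permFin 4)).eq with h3 | h3 | h3 <;> rw [h3]
    · exact one_mem _
    · exact Subgroup.mem_zpowers _
    · exact pow_mem (Subgroup.mem_zpowers _) 2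
  let : CommGroup (Subgroup.zpowers (permFin 4 u)) :=
    { mul_comm := mul_comm' }
  have h3 := congrArg Subtype.val
    (hom_eq_zpow_len (A := Subgroup.zpowers (permFin 4 u))
      (((permFin 4).comp ρ).codRestrict _ hmem) (centre 4))
  change permFin 4 (ρ (centre 4)) = permFin 4 (ρ (s 4 0)) ^ (len 4 (centre 4)).toAdd at h3
  rw [h3, centre, len_jmProd_one (by omega)]
  obtain ⟨m, hm⟩ := hmem (s 4 0)
  change permFin 4 u ^ m = _ at hm
  rw [← hm, ← zpow_mul, mul_comm, zpow_mul]
  change (permFin 4 u ^ ((12 : ℕ) : ℤ)) ^ m = 1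
  rw [zpow_natCast, key3 _ h2, one_zpow]

theorem exists_map_centre_eq (hn : 4 ≤ n) (hρ : Function.Injective ρ) :
    ∃ c : ℤ, ρ (centre n) = centre n ^ c := by
  obtain ⟨c, q, hq, hu⟩ := exists_finite_order (by omega) hρ
  refine ⟨c, mul_inv_eq_one.1 (eq_one_of_zpow_eq_one (permFin_eq_one_iff.1 ?_) hq hu)⟩
  have hc := Subgroup.mem_center_iff.1 (centre_mem_center (n := n) (by omega))
  have hcomm (g : BraidGroup n) : Commute (ρ (centre n) * (centre n ^ c)⁻¹) (ρ g) :=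
    Commute.mul_left (Commute.map (hc g).symm ρ) (Commute.zpow_left (hc (ρ g)).symm c).inv_left
  obtain rfl | hn := hn.eq_or_lt
  · by_contra hτ
    have h1 := permFin_four_map_centre hq hu hcomm hτ
    have h2 := permFin_eq_one_iff.2 (perm_centre (n := 4) (by omega))
    rw [map_mul, map_inv, map_zpow, h1, h2] at hτ
    simp at hτ
  · exact permFin_eq_one_of_commute hn hρ hq hu hcomm

theorem map_mem_center (hn : 4 ≤ n) (hρ : Function.Injective ρ) {x : BraidGroup n}
    (hx : x ∈ Subgroup.center (BraidGroup n)) : ρ x ∈ Subgroup.center (BraidGroup n) := by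
  obtain ⟨k, rfl⟩ := mem_zpowers_of_mem_center (by omega) hx
  obtain ⟨c, hc⟩ := exists_map_centre_eq hn hρ
  change ρ (centre n ^ k) ∈ _
  rw [map_zpow, hc]
  exact zpow_mem (zpow_mem (centre_mem_center (by omega)) c) k

end Main

end Braid

/-- For `n ≥ 4`, any injective endomorphism of `B_n` maps the center into
the center; equivalently, the image of the full twist `z` is central. -/
theorem braidGroup_inj_endo_center_le_center (n : ℕ) (hn : 4 ≤ n)
    (ρ : BraidGroup n →* BraidGroup n) (hρ : Function.Injective ρ) :
    (Subgroup.center (BraidGroup n)).map ρ ≤ Subgroup.center (BraidGroup n) ∧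
    ρ (fullTwist n) ∈ Subgroup.center (BraidGroup n) := by
  refine ⟨?_, Braid.map_mem_center hn hρ (Braid.fullTwist_mem_center (by omega))⟩
  rintro _ ⟨x, hx, rfl⟩
  exact Braid.map_mem_center hn hρ hx
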